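/- arXiv:2408.04359 — 2 statements merged into one kernel-verified Lean document; each statement's English description precedes it below -/
import Mathlib

section
/- Suppose 4·s⋆·log p ≤ n, p ≥ 3, and 2√2·log(4·s⋆·log(n·p)) ≤ ‖θ₀‖₂, and let S₀ = {j : θ₀ⱼ ≠ 0}. Then with probability at least 1 − 5·exp(−n/48) − 2/(n·p), simultaneously for every S ∈ 𝒮_{s⋆} with S ⊇ S₀, the matrix V_{n,S} = ∑_{i=1}^n exp(X_iᵀθ₀)·X_{i,S}X_{i,S}ᵀ is positive definite and max_{1≤i≤n} ‖V_{n,S}^{−1/2}X_{i,S}‖₂ ≤ 6√2·n^{−1/2}. -/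
open MeasureTheory ProbabilityTheory Matrix Real

/-- The law of an `n × p` matrix with i.i.d. standard normal entries. -/
noncomputable def gaussMat (n p : ℕ) : Measure (Fin n → Fin p → ℝ) :=
  Measure.pi fun _ : Fin n => Measure.pi fun _ : Fin p => gaussianReal 0 1

/-- Weighted Gram matrix `∑ᵢ wᵢ · X_{i,S} X_{i,S}ᵀ`. -/
noncomputable def gramW {n p : ℕ} (S : Finset (Fin p)) (w : Fin n → ℝ)
    (x : Fin n → Fin p → ℝ) : Matrix S S ℝ :=
  Matrix.of fun j k => ∑ i, w i * x i j.1 * x i k.1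

theorem lintegral_pi_prod {ι α : Type*} [Fintype ι] [MeasurableSpace α] (μ : Measure α)
    [IsProbabilityMeasure μ] (f : ι → α → ENNReal) (hf : ∀ i, Measurable (f i)) :
    ∫⁻ x, ∏ i, f i (x i) ∂(Measure.pi fun _ : ι => μ) = ∏ i, ∫⁻ y, f i y ∂μ := by
  have hind : iIndepFun (fun i (x : ι → α) => f i (x i)) (Measure.pi fun _ : ι => μ) :=
    iIndepFun_pi (μ := fun _ : ι => μ) (X := f) (fun i => (hf i).aemeasurable)
  rw [lintegral_prod_eq_prod_lintegral_of_indepFun Finset.univ _ hind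
    (fun i => (hf i).comp (measurable_pi_apply i))]
  exact Finset.prod_congr rfl fun i _ =>
    (measurePreserving_eval (fun _ : ι => μ) i).lintegral_comp (hf i)

theorem hasGaussianLaw_pi_eval {ι : Type*} [Fintype ι] (i : ι) :
    HasGaussianLaw (fun x : ι → ℝ => x i) (Measure.pi fun _ : ι => gaussianReal 0 1) := by
  refine ⟨?_⟩
  have : (Measure.pi fun _ : ι => gaussianReal 0 1).map (fun x : ι → ℝ => x i) = gaussianReal 0 1 :=
    (measurePreserving_eval (fun _ : ι => gaussianReal 0 1) i).map_eq
  rw [this]; infer_instance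

theorem iIndepFun_pi_eval {ι : Type*} [Fintype ι] :
    iIndepFun (fun i (x : ι → ℝ) => x i) (Measure.pi fun _ : ι => gaussianReal 0 1) :=
  iIndepFun_pi (μ := fun _ : ι => gaussianReal 0 1) (X := fun _ (y : ℝ) => y)
    (fun _ => aemeasurable_id)

theorem hasGaussianLaw_pi_id {ι : Type*} [Fintype ι] :
    HasGaussianLaw (fun x : ι → ℝ => x) (Measure.pi fun _ : ι => gaussianReal 0 1) :=
  iIndepFun_pi_eval.hasGaussianLaw hasGaussianLaw_pi_eval

theorem hasGaussianLaw_dotProduct_pair {ι : Type*} [Fintype ι] (u w : ι → ℝ) :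
    HasGaussianLaw (fun x : ι → ℝ => (x ⬝ᵥ u, x ⬝ᵥ w))
      (Measure.pi fun _ : ι => gaussianReal 0 1) := by
  let F : (ι → ℝ) →ₗ[ℝ] ℝ × ℝ :=
    ((dotProductBilin ℝ ℝ).flip u).prod ((dotProductBilin ℝ ℝ).flip w)
  exact hasGaussianLaw_pi_id.map_fun (LinearMap.toContinuousLinearMap F)

theorem hasGaussianLaw_dotProduct {ι : Type*} [Fintype ι] (u : ι → ℝ) :
    HasGaussianLaw (fun x : ι → ℝ => x ⬝ᵥ u) (Measure.pi fun _ : ι => gaussianReal 0 1) := by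
  let F : (ι → ℝ) →ₗ[ℝ] ℝ := (dotProductBilin ℝ ℝ).flip u
  exact hasGaussianLaw_pi_id.map_fun (LinearMap.toContinuousLinearMap F)

theorem covariance_dotProduct {ι : Type*} [Fintype ι] (u w : ι → ℝ) :
    cov[fun x : ι → ℝ => x ⬝ᵥ u, fun x => x ⬝ᵥ w; Measure.pi fun _ : ι => gaussianReal 0 1]
      = u ⬝ᵥ w := by
  classical
  have hm (i : ι) : MemLp (fun x : ι → ℝ => x i) 2 (Measure.pi fun _ : ι => gaussianReal 0 1) :=
    (hasGaussianLaw_pi_eval i).memLp_two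
  simp only [dotProduct]
  rw [covariance_fun_sum_fun_sum (fun i => (hm i).mul_const _) (fun i => (hm i).mul_const _)]
  refine Finset.sum_congr rfl fun i _ => ?_
  rw [Finset.sum_eq_single i]
  · rw [covariance_mul_const_left, covariance_mul_const_right, covariance_self (measurable_pi_apply i).aemeasurable]
    have h2 := (measurePreserving_eval (fun _ : ι => gaussianReal 0 1) i).map_eq
    have h3 : Var[fun x : ι → ℝ => x i; Measure.pi fun _ : ι => gaussianReal 0 1] = 1 := by
      have := variance_map (μ := Measure.pi fun _ : ι => gaussianReal 0 1) (Y := Function.eval i)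
        (X := fun y : ℝ => y) (by fun_prop)
        (measurable_pi_apply i).aemeasurable
      rw [h2] at this
      rw [show (fun x : ι → ℝ => x i) = (fun y : ℝ => y) ∘ Function.eval i from rfl, ← this]
      simp
    rw [h3]; ring
  · intro j _ hj
    rw [covariance_mul_const_left, covariance_mul_const_right,
      (iIndepFun_pi_eval.indepFun hj.symm).covariance_eq_zero (hm i) (hm j)]
    ring
  · simp

theorem integral_dotProduct {ι : Type*} [Fintype ι] (u : ι → ℝ) :
    ∫ x, x ⬝ᵥ u ∂(Measure.pi fun _ : ι => gaussianReal 0 1) = 0 := by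
  simp only [dotProduct]
  rw [integral_finsetSum _ fun i _ => (hasGaussianLaw_pi_eval i).integrable.mul_const _]
  refine Finset.sum_eq_zero fun i _ => ?_
  rw [integral_mul_const, integral_comp_eval (μ := fun _ : ι => gaussianReal 0 1)
    (f := fun y : ℝ => y) (by fun_prop)]
  simp

theorem map_dotProduct {ι : Type*} [Fintype ι] (u : ι → ℝ) :
    (Measure.pi fun _ : ι => gaussianReal 0 1).map (fun x : ι → ℝ => x ⬝ᵥ u)
      = gaussianReal 0 (u ⬝ᵥ u).toNNReal := by
  rw [(hasGaussianLaw_dotProduct u).map_eq_gaussianReal, integral_dotProduct,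
    ← covariance_self (hasGaussianLaw_dotProduct u).aemeasurable, covariance_dotProduct]

/-- Orthogonal linear forms of a standard Gaussian vector are independent Gaussians. -/
theorem map_dotProduct_pair {ι : Type*} [Fintype ι] (u w : ι → ℝ) (h : u ⬝ᵥ w = 0) :
    (Measure.pi fun _ : ι => gaussianReal 0 1).map (fun x : ι → ℝ => (x ⬝ᵥ u, x ⬝ᵥ w))
      = (gaussianReal 0 (u ⬝ᵥ u).toNNReal).prod (gaussianReal 0 (w ⬝ᵥ w).toNNReal) := by
  have hi := (hasGaussianLaw_dotProduct_pair u w).indepFun_of_covariance_eq_zero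
    (by rw [covariance_dotProduct, h])
  rw [indepFun_iff_map_prod_eq_prod_map_map (hasGaussianLaw_dotProduct u).aemeasurable
    (hasGaussianLaw_dotProduct w).aemeasurable] at hi
  rw [hi, map_dotProduct, map_dotProduct]

theorem integral_exp_neg_sq_gaussianReal (s : NNReal) (a b : ℝ) (ha : 0 ≤ a) :
    ∫ z, rexp (-(a / 2 * (b + z) ^ 2)) ∂(gaussianReal 0 s)
      = (√(1 + a * s))⁻¹ * rexp (-(a * b ^ 2 / (2 * (1 + a * s)))) := by
  rcases eq_or_ne s 0 with rfl | hs
  · simp; ring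
  have hs' : (0 : ℝ) < s := by positivity
  have hz : 0 < 1 + a * s := by positivity
  rw [integral_gaussianReal_eq_integral_smul hs]
  have h1 (z : ℝ) : gaussianPDFReal 0 s z • rexp (-(a / 2 * (b + z) ^ 2))
      = ((√(2 * π * s))⁻¹ * rexp (-(a * b ^ 2 / (2 * (1 + a * s))))) *
        rexp (-((1 + a * s) / (2 * s)) * (z + a * b * s / (1 + a * s)) ^ 2) := by
    rw [gaussianPDFReal, smul_eq_mul, mul_assoc _ (rexp _) (rexp _), ← Real.exp_add,
      mul_assoc _ (rexp _) (rexp _), ← Real.exp_add]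
    congr 2
    field_simp
    ring
  simp_rw [h1]
  rw [integral_const_mul, integral_add_right_eq_self
    (fun z => rexp (-((1 + a * s) / (2 * s)) * z ^ 2)), integral_gaussian,
    mul_right_comm]
  congr 1
  rw [← Real.sqrt_inv, ← Real.sqrt_inv, ← Real.sqrt_mul (by positivity)]
  congr 1
  field_simp

theorem exp_mul_le_of_exp_le {ψ a g ρ s : ℝ} (ha : 0 ≤ a) (hs : 0 ≤ s) (hV : 1 ≤ ρ ^ 2 + s)
    (h : (a = 0 ∧ ψ = 0) ∨ ∃ τ > 0, τ ≤ g ∧ rexp (2 * ψ) * rexp (τ ^ 2 - 1) ≤ τ ^ 2 * (1 + a)) :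
    rexp ψ * ((√(1 + a * s))⁻¹ * rexp (-(a * (ρ * g) ^ 2 / (2 * (1 + a * s))))) ≤ 1 := by
  rcases h with ⟨rfl, rfl⟩ | ⟨τ, hτ, hτg, h⟩
  · simp
  have hz : 0 < 1 + a * s := by positivity
  set z := 1 + a * s with hzdef
  set y := a * ρ ^ 2 / z with hy
  have hy0 : 0 ≤ y := by positivity
  have hyz : z * (1 + y) = 1 + a * (ρ ^ 2 + s) := by rw [hy]; field_simp; rw [hzdef]; ring
  have h2 : 1 + a ≤ z * (1 + y) := by rw [hyz]; nlinarith
  have hg : τ ^ 2 ≤ g ^ 2 := by gcongr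
  have hX := Real.add_one_le_exp (τ ^ 2 * (1 + y) - 1)
  have key : rexp (2 * ψ) * rexp (-(y * g ^ 2)) ≤ z := by
    have e1 : rexp (2 * ψ) * rexp (τ ^ 2 - 1) ≤ z * rexp (τ ^ 2 * (1 + y) - 1) := by
      calc _ ≤ τ ^ 2 * (1 + a) := h
        _ ≤ τ ^ 2 * (z * (1 + y)) := by gcongr
        _ = z * (τ ^ 2 * (1 + y)) := by ring
        _ ≤ _ := by gcongr; linarith
    have e2 : rexp (τ ^ 2 * (1 + y) - 1) = rexp (τ ^ 2 - 1) * rexp (τ ^ 2 * y) := by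
      rw [← Real.exp_add]; ring_nf
    have e3 : rexp (2 * ψ) ≤ z * rexp (τ ^ 2 * y) := by
      rw [e2] at e1
      have := Real.exp_pos (τ ^ 2 - 1)
      nlinarith
    calc _ ≤ z * rexp (τ ^ 2 * y) * rexp (-(y * τ ^ 2)) := by gcongr
      _ = z := by rw [mul_assoc, ← Real.exp_add]; ring_nf; simp
  have hsq : (rexp ψ * ((√z)⁻¹ * rexp (-(a * (ρ * g) ^ 2 / (2 * z))))) ^ 2 ≤ 1 := by
    have : (rexp ψ * ((√z)⁻¹ * rexp (-(a * (ρ * g) ^ 2 / (2 * z))))) ^ 2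
        = z⁻¹ * (rexp (2 * ψ) * rexp (-(y * g ^ 2))) := by
      rw [mul_pow, mul_pow, inv_pow, Real.sq_sqrt hz.le, ← Real.exp_nat_mul, ← Real.exp_nat_mul]
      have : ((2 : ℕ) : ℝ) * -(a * (ρ * g) ^ 2 / (2 * z)) = -(y * g ^ 2) := by
        rw [hy]; push_cast; field_simp
      rw [this]; push_cast; ring
    rw [this, inv_mul_le_iff₀ hz, mul_one]; exact key
  exact (sq_le_one_iff₀ (by positivity)).1 hsq

/-- Exponential moment bound for one row of the Gaussian design. -/
theorem lintegral_exp_row_le_one {ι : Type*} [Fintype ι] (u v : ι → ℝ) (hu : u ⬝ᵥ u = 1)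
    (hv : 1 ≤ v ⬝ᵥ v) (a ψ : ℝ → ℝ) (ham : Measurable a) (hψm : Measurable ψ) (ha : ∀ g, 0 ≤ a g)
    (h : ∀ g, (a g = 0 ∧ ψ g = 0) ∨
      ∃ τ > 0, τ ≤ g ∧ rexp (2 * ψ g) * rexp (τ ^ 2 - 1) ≤ τ ^ 2 * (1 + a g)) :
    ∫⁻ x, ENNReal.ofReal (rexp (ψ (x ⬝ᵥ u) - a (x ⬝ᵥ u) / 2 * (x ⬝ᵥ v) ^ 2))
      ∂(Measure.pi fun _ : ι => gaussianReal 0 1) ≤ 1 := by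
  set ρ := u ⬝ᵥ v with hρ
  set w := v - ρ • u with hw
  have huw : u ⬝ᵥ w = 0 := by
    rw [hw, dotProduct_sub, dotProduct_smul, hu, ← hρ]; simp
  have hvw : v = ρ • u + w := by rw [hw]; abel
  have hww : v ⬝ᵥ v = ρ ^ 2 + w ⬝ᵥ w := by
    rw [hvw]
    simp only [add_dotProduct, dotProduct_add, smul_dotProduct, dotProduct_smul, hu, huw,
      dotProduct_comm w u, smul_eq_mul]
    ring
  have hw0 : 0 ≤ w ⬝ᵥ w := Finset.sum_nonneg fun i _ => mul_self_nonneg _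
  let F : ℝ × ℝ → ENNReal := fun q =>
    ENNReal.ofReal (rexp (ψ q.1 - a q.1 / 2 * (ρ * q.1 + q.2) ^ 2))
  have hF : Measurable F := by fun_prop
  have hmeas : Measurable (fun x : ι → ℝ => (x ⬝ᵥ u, x ⬝ᵥ w)) := by
    simp only [dotProduct]; fun_prop
  have hsub : ∀ x : ι → ℝ, ENNReal.ofReal (rexp (ψ (x ⬝ᵥ u) - a (x ⬝ᵥ u) / 2 * (x ⬝ᵥ v) ^ 2))
      = F (x ⬝ᵥ u, x ⬝ᵥ w) := by
    intro x
    simp only [F]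
    rw [hvw, dotProduct_add, dotProduct_smul, smul_eq_mul]
  simp_rw [hsub]
  rw [← lintegral_map hF hmeas, map_dotProduct_pair u w huw, lintegral_prod _ hF.aemeasurable]
  calc _ ≤ ∫⁻ _, 1 ∂(gaussianReal 0 (u ⬝ᵥ u).toNNReal) := by
        refine lintegral_mono fun g => ?_
        have h1 : ∀ z, F (g, z) = ENNReal.ofReal (rexp (ψ g)) *
            ENNReal.ofReal (rexp (-(a g / 2 * (ρ * g + z) ^ 2))) := by
          intro z
          rw [← ENNReal.ofReal_mul (Real.exp_pos _).le, ← Real.exp_add, ← sub_eq_add_neg]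
        simp_rw [h1]
        rw [lintegral_const_mul _ (by fun_prop), ← ofReal_integral_eq_lintegral_ofReal,
          integral_exp_neg_sq_gaussianReal _ _ _ (ha g), ← ENNReal.ofReal_mul (Real.exp_pos _).le]
        · refine ENNReal.ofReal_le_one.2 (exp_mul_le_of_exp_le (ha g) (by positivity) ?_ (h g))
          rw [Real.coe_toNNReal _ hw0, ← hww]; exact hv
        · refine Integrable.of_bound (C := 1) (by fun_prop) (ae_of_all _ fun z => ?_)
          rw [Real.norm_eq_abs, Real.abs_exp, Real.exp_le_one_iff]
          have := ha g
          have : 0 ≤ a g / 2 * (ρ * g + z) ^ 2 := by positivity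
          linarith
        · exact ae_of_all _ fun z => (Real.exp_pos _).le
    _ = 1 := by simp

/-- The uniform distribution on the unit interval centred at the origin. -/
noncomputable def unifCentered : Measure ℝ := volume.restrict (Set.Icc (-(1 / 2)) (1 / 2))

instance : IsProbabilityMeasure unifCentered :=
  ⟨by simp [unifCentered]; norm_num⟩

theorem memLp_unifCentered : MemLp (fun y : ℝ => y) 2 unifCentered := by
  refine MemLp.of_bound (by fun_prop) (1 / 2) ?_
  refine (ae_restrict_iff' measurableSet_Icc).2 (ae_of_all _ fun y hy => ?_)
  rw [Real.norm_eq_abs, abs_le]; exact hy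

theorem integral_unifCentered : ∫ y, y ∂unifCentered = 0 := by
  rw [unifCentered, integral_Icc_eq_integral_Ioc,
    ← intervalIntegral.integral_of_le (by norm_num)]
  simp

theorem integral_sq_unifCentered : ∫ y, y ^ 2 ∂unifCentered = 1 / 12 := by
  rw [unifCentered, integral_Icc_eq_integral_Ioc,
    ← intervalIntegral.integral_of_le (by norm_num), integral_pow]
  norm_num

theorem variance_unifCentered : Var[fun y : ℝ => y; unifCentered] = 1 / 12 := by
  rw [variance_of_integral_eq_zero (by fun_prop) integral_unifCentered]
  exact integral_sq_unifCentered

section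

variable {ι : Type*} [Fintype ι]

theorem memLp_dotProduct_unifCentered (c : ι → ℝ) :
    MemLp (fun s : ι → ℝ => c ⬝ᵥ s) 2 (Measure.pi fun _ : ι => unifCentered) := by
  simp only [dotProduct]
  refine memLp_finsetSum _ fun i _ => ?_
  exact (memLp_unifCentered.comp_measurePreserving
    (measurePreserving_eval (fun _ : ι => unifCentered) i)).const_mul (c i)

theorem integral_dotProduct_unifCentered (c : ι → ℝ) :
    ∫ s, c ⬝ᵥ s ∂(Measure.pi fun _ : ι => unifCentered) = 0 := by
  simp only [dotProduct]
  rw [integral_finsetSum]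
  · refine Finset.sum_eq_zero fun i _ => ?_
    rw [integral_const_mul, integral_comp_eval (μ := fun _ : ι => unifCentered)
      (f := fun y : ℝ => y) (by fun_prop), integral_unifCentered, mul_zero]
  · intro i _
    exact ((memLp_unifCentered.comp_measurePreserving
      (measurePreserving_eval (fun _ : ι => unifCentered) i)).const_mul (c i)).integrable
      one_le_two

theorem integral_dotProduct_sq_unifCentered (c : ι → ℝ) :
    ∫ s, (c ⬝ᵥ s) ^ 2 ∂(Measure.pi fun _ : ι => unifCentered) = c ⬝ᵥ c / 12 := by
  have h := variance_of_integral_eq_zero (memLp_dotProduct_unifCentered c).aemeasurable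
    (integral_dotProduct_unifCentered c)
  rw [← h]
  have h2 := variance_sum_pi (μ := fun _ : ι => unifCentered) (X := fun i y => c i * y)
    (fun i => memLp_unifCentered.const_mul (c i))
  have h3 : (fun s : ι → ℝ => c ⬝ᵥ s) = ∑ i, fun s : ι → ℝ => c i * s i := by
    ext s; simp [dotProduct]
  rw [h3, h2, dotProduct, Finset.sum_div]
  refine Finset.sum_congr rfl fun i _ => ?_
  rw [variance_const_mul, variance_unifCentered]
  ring

/-- Jensen's inequality for a Gaussian weight averaged over a unit cube. -/
theorem exp_quadratic_le_lintegral_cube {R : Type*} [Fintype R] (w : R → ℝ) (hw : ∀ r, 0 ≤ w r)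
    (c : R → ι → ℝ) (z₀ : ι → ℝ) :
    ENNReal.ofReal (rexp (-(1 / 2) * ∑ r, w r * ((c r ⬝ᵥ z₀) ^ 2 + c r ⬝ᵥ c r / 12)))
      ≤ ∫⁻ s, ENNReal.ofReal (rexp (-(1 / 2) * ∑ r, w r * (c r ⬝ᵥ (z₀ + s)) ^ 2))
        ∂(Measure.pi fun _ : ι => unifCentered) := by
  set μ := Measure.pi fun _ : ι => unifCentered
  have hL (r : R) := memLp_dotProduct_unifCentered (c r)
  have hI1 (r : R) : Integrable (fun s => c r ⬝ᵥ s) μ := (hL r).integrable one_le_two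
  have hI2 (r : R) : Integrable (fun s => (c r ⬝ᵥ s) ^ 2) μ := (hL r).integrable_sq
  have hexpand (r : R) (s : ι → ℝ) : w r * (c r ⬝ᵥ (z₀ + s)) ^ 2
      = w r * (c r ⬝ᵥ z₀) ^ 2 + (2 * w r * (c r ⬝ᵥ z₀)) * (c r ⬝ᵥ s) + w r * (c r ⬝ᵥ s) ^ 2 := by
    rw [dotProduct_add]; ring
  have hI (r : R) : Integrable (fun s => w r * (c r ⬝ᵥ (z₀ + s)) ^ 2) μ := by
    simp_rw [hexpand]
    exact ((integrable_const _).add ((hI1 r).const_mul _)).add ((hI2 r).const_mul _)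
  have hI3 (r : R) : Integrable
      (fun s => w r * (c r ⬝ᵥ z₀) ^ 2 + (2 * w r * (c r ⬝ᵥ z₀)) * (c r ⬝ᵥ s)) μ :=
    (integrable_const _).add ((hI1 r).const_mul _)
  have hint (r : R) : ∫ s, w r * (c r ⬝ᵥ (z₀ + s)) ^ 2 ∂μ
      = w r * ((c r ⬝ᵥ z₀) ^ 2 + c r ⬝ᵥ c r / 12) := by
    simp_rw [hexpand]
    rw [integral_add (hI3 r) ((hI2 r).const_mul _),
      integral_add (integrable_const _) ((hI1 r).const_mul _), integral_const_mul,
      integral_const_mul, integral_const_mul, integral_dotProduct_unifCentered, integral_dotProduct_sq_unifCentered]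
    simp only [integral_const, probReal_univ, smul_eq_mul]
    ring
  set m := ∑ r, w r * ((c r ⬝ᵥ z₀) ^ 2 + c r ⬝ᵥ c r / 12) with hm
  have hQ : Integrable (fun s => ∑ r, w r * (c r ⬝ᵥ (z₀ + s)) ^ 2) μ :=
    integrable_finsetSum _ fun r _ => hI r
  have hQint : ∫ s, ∑ r, w r * (c r ⬝ᵥ (z₀ + s)) ^ 2 ∂μ = m := by
    rw [integral_finsetSum _ fun r _ => hI r, hm]
    exact Finset.sum_congr rfl fun r _ => hint r
  have hQm : Integrable (fun s => (1 / 2) * (∑ r, w r * (c r ⬝ᵥ (z₀ + s)) ^ 2 - m)) μ :=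
    (hQ.sub (integrable_const _)).const_mul _
  have hE : Integrable (fun s => rexp (-(1 / 2) * ∑ r, w r * (c r ⬝ᵥ (z₀ + s)) ^ 2)) μ := by
    refine Integrable.of_bound (C := 1) ?_ (ae_of_all _ fun s => ?_)
    · exact (Real.continuous_exp.measurable.comp_aemeasurable
        (hQ.aemeasurable.const_mul _)).aestronglyMeasurable
    · rw [Real.norm_eq_abs, Real.abs_exp, Real.exp_le_one_iff]
      have : 0 ≤ ∑ r, w r * (c r ⬝ᵥ (z₀ + s)) ^ 2 :=
        Finset.sum_nonneg fun r _ => mul_nonneg (hw r) (sq_nonneg _)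
      linarith
  rw [← ofReal_integral_eq_lintegral_ofReal hE (ae_of_all _ fun s => (Real.exp_pos _).le)]
  refine ENNReal.ofReal_le_ofReal ?_
  have hlow : Integrable (fun s => rexp (-(1 / 2) * m) *
      (1 - (1 / 2) * (∑ r, w r * (c r ⬝ᵥ (z₀ + s)) ^ 2 - m))) μ :=
    ((integrable_const _).sub hQm).const_mul _
  calc rexp (-(1 / 2) * m) = ∫ s, rexp (-(1 / 2) * m) *
      (1 - (1 / 2) * (∑ r, w r * (c r ⬝ᵥ (z₀ + s)) ^ 2 - m)) ∂μ := by
        rw [integral_const_mul, integral_sub (integrable_const _) hQm, integral_const_mul,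
          integral_sub hQ (integrable_const _), hQint]
        simp
    _ ≤ _ := by
        refine integral_mono hlow hE fun s => ?_
        set q := ∑ r, w r * (c r ⬝ᵥ (z₀ + s)) ^ 2
        have h1 : rexp (-(1 / 2) * q) = rexp (-(1 / 2) * m) * rexp (-(1 / 2) * (q - m)) := by
          rw [← Real.exp_add]; ring_nf
        show _ ≤ rexp (-(1 / 2) * q)
        rw [h1]
        gcongr
        have := Real.add_one_le_exp (-(1 / 2) * (q - m))
        linarith

theorem pi_unifCentered :
    (Measure.pi fun _ : ι => unifCentered)
      = volume.restrict (Set.pi Set.univ fun _ : ι => Set.Icc (-(1 / 2) : ℝ) (1 / 2)) := by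
  rw [volume_pi, Measure.restrict_pi_pi]; rfl

end

instance (n p : ℕ) : IsProbabilityMeasure (gaussMat n p) := by
  unfold gaussMat; infer_instance

theorem lintegral_exp_matrix_le_one {n p : ℕ} (u v : Fin p → ℝ) (hu : u ⬝ᵥ u = 1)
    (hv : 1 ≤ v ⬝ᵥ v) (a ψ : ℝ → ℝ) (ham : Measurable a) (hψm : Measurable ψ) (ha : ∀ g, 0 ≤ a g)
    (h : ∀ g, (a g = 0 ∧ ψ g = 0) ∨
      ∃ τ > 0, τ ≤ g ∧ rexp (2 * ψ g) * rexp (τ ^ 2 - 1) ≤ τ ^ 2 * (1 + a g)) :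
    ∫⁻ x, ENNReal.ofReal (rexp (∑ i, (ψ (x i ⬝ᵥ u) - a (x i ⬝ᵥ u) / 2 * (x i ⬝ᵥ v) ^ 2)))
      ∂(gaussMat n p) ≤ 1 := by
  simp_rw [Real.exp_sum, ENNReal.ofReal_prod_of_nonneg fun _ _ => (Real.exp_pos _).le]
  rw [gaussMat, lintegral_pi_prod (Measure.pi fun _ : Fin p => gaussianReal 0 1)
    (fun _ y => ENNReal.ofReal (rexp (ψ (y ⬝ᵥ u) - a (y ⬝ᵥ u) / 2 * (y ⬝ᵥ v) ^ 2)))]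
  · exact Finset.prod_le_one' fun _ _ => lintegral_exp_row_le_one u v hu hv a ψ ham hψm ha h
  · intro _; simp only [dotProduct]; fun_prop

theorem lintegral_exp_neg_sum_sq {ι : Type*} [Fintype ι] (b : ℝ) (hb : 0 < b) :
    ∫⁻ z : ι → ℝ, ENNReal.ofReal (rexp (-(b * (z ⬝ᵥ z))))
      = ENNReal.ofReal (√(π / b) ^ Fintype.card ι) := by
  have h1 (z : ι → ℝ) : rexp (-(b * (z ⬝ᵥ z))) = ∏ i, rexp (-b * z i ^ 2) := by
    rw [← Real.exp_sum, dotProduct, Finset.mul_sum, ← Finset.sum_neg_distrib]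
    congr 1; exact Finset.sum_congr rfl fun i _ => by ring
  simp_rw [h1]
  rw [← ofReal_integral_eq_lintegral_ofReal]
  · rw [integral_fintype_prod_volume_eq_pow (fun y : ℝ => rexp (-b * y ^ 2)), integral_gaussian]
  · exact Integrable.fintype_prod (f := fun _ : ι => fun y : ℝ => rexp (-b * y ^ 2))
      fun _ => integrable_exp_neg_mul_sq hb
  · exact ae_of_all _ fun z => Finset.prod_nonneg fun _ _ => (Real.exp_pos _).le

/-- Extension by zero of a vector indexed by a set of coordinates. -/
def extendVec {p : ℕ} (S : Finset (Fin p)) (z : S → ℝ) (j : Fin p) : ℝ :=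
  if h : j ∈ S then z ⟨j, h⟩ else 0

theorem dotProduct_extendVec {p : ℕ} (S : Finset (Fin p)) (y : Fin p → ℝ) (z : S → ℝ) :
    y ⬝ᵥ extendVec S z = (fun l : S => y l.1) ⬝ᵥ z := by
  simp only [dotProduct]
  rw [← Finset.sum_subset (Finset.subset_univ S), ← Finset.sum_coe_sort]
  · exact Finset.sum_congr rfl fun l _ => by simp [extendVec]
  · intro j _ hj; simp [extendVec, hj]

theorem extendVec_dotProduct_self {p : ℕ} (S : Finset (Fin p)) (z : S → ℝ) :
    extendVec S z ⬝ᵥ extendVec S z = z ⬝ᵥ z := by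
  rw [dotProduct_extendVec]
  congr 1; ext l; simp [extendVec]

section

variable {n p : ℕ} (S : Finset (Fin p)) (u : Fin p → ℝ) (a ψ : ℝ → ℝ) (κ H : ℝ)

/-- The exponent of the Laplace functional used in the chaining-free lower tail bound. -/
noncomputable def laplaceExponent (x : Fin n → Fin p → ℝ) (z : S → ℝ) : ℝ :=
  (∑ i, (ψ (x i ⬝ᵥ u) - a (x i ⬝ᵥ u) / 2 * (x i ⬝ᵥ extendVec S (H • z)) ^ 2))
    - κ * H ^ 2 / 2 * (z ⬝ᵥ z)

/-- The integrand of the Laplace functional, supported on `‖H z‖ ≥ 1`. -/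
noncomputable def laplaceDensity (x : Fin n → Fin p → ℝ) (z : S → ℝ) : ENNReal :=
  {z : S → ℝ | 1 ≤ H ^ 2 * (z ⬝ᵥ z)}.indicator
    (fun z => ENNReal.ofReal (rexp (laplaceExponent S u a ψ κ H x z))) z

variable {a ψ}

theorem measurable_laplaceDensity (ham : Measurable a) (hψm : Measurable ψ) :
    Measurable (Function.uncurry (laplaceDensity (n := n) S u a ψ κ H)) := by
  have h1 : MeasurableSet {q : (Fin n → Fin p → ℝ) × (S → ℝ) | 1 ≤ H ^ 2 * (q.2 ⬝ᵥ q.2)} := by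
    refine measurableSet_le measurable_const ?_
    simp only [dotProduct]; fun_prop
  have h2 : Measurable fun q : (Fin n → Fin p → ℝ) × (S → ℝ) =>
      ENNReal.ofReal (rexp (laplaceExponent S u a ψ κ H q.1 q.2)) := by
    simp only [laplaceExponent, dotProduct_extendVec]
    simp only [dotProduct, Pi.smul_apply]
    fun_prop
  exact h2.indicator h1

theorem lintegral_laplace_le (hu : u ⬝ᵥ u = 1) (ham : Measurable a) (hψm : Measurable ψ)
    (ha : ∀ g, 0 ≤ a g)
    (h : ∀ g, (a g = 0 ∧ ψ g = 0) ∨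
      ∃ τ > 0, τ ≤ g ∧ rexp (2 * ψ g) * rexp (τ ^ 2 - 1) ≤ τ ^ 2 * (1 + a g))
    (hκ : 0 < κ) (hH : 0 < H) :
    ∫⁻ x, (∫⁻ z, laplaceDensity S u a ψ κ H x z) ∂(gaussMat n p)
      ≤ ENNReal.ofReal (√(π / (κ * H ^ 2 / 2)) ^ S.card) := by
  rw [lintegral_lintegral_swap (measurable_laplaceDensity S u κ H ham hψm).aemeasurable]
  calc _ ≤ ∫⁻ z : S → ℝ, ENNReal.ofReal (rexp (-(κ * H ^ 2 / 2 * (z ⬝ᵥ z)))) := by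
        refine lintegral_mono fun z => ?_
        by_cases hz : 1 ≤ H ^ 2 * (z ⬝ᵥ z)
        · have hv : 1 ≤ extendVec S (H • z) ⬝ᵥ extendVec S (H • z) := by
            rw [extendVec_dotProduct_self, smul_dotProduct, dotProduct_smul, smul_eq_mul,
              smul_eq_mul]
            linarith
          have h1 (x : Fin n → Fin p → ℝ) : laplaceDensity S u a ψ κ H x z
              = ENNReal.ofReal (rexp (-(κ * H ^ 2 / 2 * (z ⬝ᵥ z)))) *
                ENNReal.ofReal (rexp (∑ i, (ψ (x i ⬝ᵥ u)
                  - a (x i ⬝ᵥ u) / 2 * (x i ⬝ᵥ extendVec S (H • z)) ^ 2))) := by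
            rw [laplaceDensity, Set.indicator_of_mem (by exact hz), laplaceExponent,
              ← ENNReal.ofReal_mul (Real.exp_pos _).le, ← Real.exp_add]
            ring_nf
          simp_rw [h1]
          rw [lintegral_const_mul]
          · exact mul_le_of_le_one_right' (lintegral_exp_matrix_le_one u _ hu hv a ψ ham hψm ha h)
          · simp only [dotProduct]; fun_prop
        · have h1 (x : Fin n → Fin p → ℝ) : laplaceDensity S u a ψ κ H x z = 0 := by
            rw [laplaceDensity, Set.indicator_of_notMem (by exact hz)]
          simp [h1]
    _ = _ := by
        rw [lintegral_exp_neg_sum_sq _ (by positivity), Fintype.card_coe]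

theorem le_lintegral_laplace (ha : ∀ g, 0 ≤ a g) (hκ : 0 < κ) (hH : 0 < H) {A N T B η : ℝ}
    (hA : ∀ g, a g ≤ A) (hη : 0 ≤ η) (hηH : H ^ 2 * S.card / 4 ≤ η ^ 2)
    (x : Fin n → Fin p → ℝ) (hB : B ≤ ∑ i, ψ (x i ⬝ᵥ u)) (hT : ∀ j, ∑ i, x i j ^ 2 ≤ T)
    (v : S → ℝ) (hv : v ⬝ᵥ v = 1)
    (hN : ∑ i, a (x i ⬝ᵥ u) * (x i ⬝ᵥ extendVec S v) ^ 2 ≤ N) :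
    ENNReal.ofReal (rexp (B - 1 / 2 * ((1 + η) ^ 2 * N + H ^ 2 / 12 * A * T * S.card
      + κ * ((1 + η) ^ 2 + H ^ 2 / 12 * S.card))))
      ≤ ∫⁻ z, laplaceDensity S u a ψ κ H x z := by
  classical
  set z₀ : S → ℝ := ((1 + η) / H) • v with hz₀
  have hbox (s : S → ℝ) (hs : s ∈ Set.pi Set.univ fun _ : S => Set.Icc (-(1 / 2) : ℝ) (1 / 2)) :
      1 ≤ H ^ 2 * ((z₀ + s) ⬝ᵥ (z₀ + s)) := by
    have hss : s ⬝ᵥ s ≤ S.card / 4 := by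
      calc s ⬝ᵥ s ≤ ∑ _l : S, (1 / 4 : ℝ) := by
            refine Finset.sum_le_sum fun l _ => ?_
            have := hs l (Set.mem_univ _)
            nlinarith [this.1, this.2]
        _ = _ := by simp; ring
    have hcs : (s ⬝ᵥ v) ^ 2 ≤ s ⬝ᵥ s := by
      have := Finset.sum_mul_sq_le_sq_mul_sq Finset.univ s v
      have e : ∑ i, v i ^ 2 = 1 := by rw [← hv]; simp [dotProduct, pow_two]
      rw [e, mul_one] at this
      simpa [dotProduct, pow_two] using this
    have hcs2 : ((z₀ + s) ⬝ᵥ v) ^ 2 ≤ (z₀ + s) ⬝ᵥ (z₀ + s) := by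
      have := Finset.sum_mul_sq_le_sq_mul_sq Finset.univ (z₀ + s) v
      have e : ∑ i, v i ^ 2 = 1 := by rw [← hv]; simp [dotProduct, pow_two]
      rw [e, mul_one] at this
      simpa [dotProduct, pow_two] using this
    have h1 : (H * (s ⬝ᵥ v)) ^ 2 ≤ η ^ 2 := by
      calc (H * (s ⬝ᵥ v)) ^ 2 = H ^ 2 * (s ⬝ᵥ v) ^ 2 := by ring
        _ ≤ H ^ 2 * (S.card / 4) := by gcongr; linarith
        _ ≤ η ^ 2 := by linarith
    have h2 := (abs_le_of_sq_le_sq' h1 hη).1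
    have h3 : H * ((z₀ + s) ⬝ᵥ v) = 1 + η + H * (s ⬝ᵥ v) := by
      rw [add_dotProduct, hz₀, smul_dotProduct, hv, smul_eq_mul]; field_simp
    have h4 : 1 ≤ H * ((z₀ + s) ⬝ᵥ v) := by rw [h3]; linarith
    calc (1 : ℝ) ≤ (H * ((z₀ + s) ⬝ᵥ v)) ^ 2 := by nlinarith
      _ = H ^ 2 * ((z₀ + s) ⬝ᵥ v) ^ 2 := by ring
      _ ≤ _ := by gcongr
  let w : Fin n ⊕ S → ℝ := Sum.elim (fun i => a (x i ⬝ᵥ u) * H ^ 2) (fun _ => κ * H ^ 2)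
  let c : Fin n ⊕ S → S → ℝ := Sum.elim (fun i l => x i l.1) (fun l => Pi.single l 1)
  have hw : ∀ r, 0 ≤ w r := by
    rintro (i | l)
    · have := ha (x i ⬝ᵥ u); simp only [w, Sum.elim_inl]; positivity
    · simp only [w, Sum.elim_inr]; positivity
  have hexp (z : S → ℝ) : laplaceExponent S u a ψ κ H x z
      = ∑ i, ψ (x i ⬝ᵥ u) + -(1 / 2) * ∑ r, w r * (c r ⬝ᵥ z) ^ 2 := by
    simp only [laplaceExponent, Fintype.sum_sum_type, w, c, Sum.elim_inl, Sum.elim_inr,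
      single_dotProduct, dotProduct_extendVec, dotProduct_smul, smul_eq_mul, one_mul,
      Finset.sum_sub_distrib]
    rw [← Finset.mul_sum]
    have e1 : ∑ i, a (x i ⬝ᵥ u) / 2 * (H * (fun l : S => x i l.1) ⬝ᵥ z) ^ 2
        = 1 / 2 * ∑ i, a (x i ⬝ᵥ u) * H ^ 2 * ((fun l : S => x i l.1) ⬝ᵥ z) ^ 2 := by
      rw [Finset.mul_sum]; exact Finset.sum_congr rfl fun i _ => by ring
    have e2 : z ⬝ᵥ z = ∑ l, z l ^ 2 := by simp [dotProduct, pow_two]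
    rw [e1, e2]; ring
  have hjen := exp_quadratic_le_lintegral_cube w hw c z₀
  have hquad : ∑ r, w r * ((c r ⬝ᵥ z₀) ^ 2 + c r ⬝ᵥ c r / 12)
      ≤ (1 + η) ^ 2 * N + H ^ 2 / 12 * A * T * S.card
        + κ * ((1 + η) ^ 2 + H ^ 2 / 12 * S.card) := by
    have e1 : ∑ i : Fin n, w (.inl i) * ((c (.inl i) ⬝ᵥ z₀) ^ 2 + c (.inl i) ⬝ᵥ c (.inl i) / 12)
        ≤ (1 + η) ^ 2 * N + H ^ 2 / 12 * A * T * S.card := by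
      have f1 : ∑ i : Fin n, w (.inl i) * (c (.inl i) ⬝ᵥ z₀) ^ 2 ≤ (1 + η) ^ 2 * N := by
        calc _ = (1 + η) ^ 2 * ∑ i, a (x i ⬝ᵥ u) * (x i ⬝ᵥ extendVec S v) ^ 2 := by
              rw [Finset.mul_sum]
              refine Finset.sum_congr rfl fun i _ => ?_
              simp only [w, c, Sum.elim_inl, hz₀, dotProduct_smul, dotProduct_extendVec,
                smul_eq_mul]
              field_simp
          _ ≤ _ := by gcongr
      have f2 : ∑ i : Fin n, w (.inl i) * (c (.inl i) ⬝ᵥ c (.inl i) / 12)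
          ≤ H ^ 2 / 12 * A * T * S.card := by
        have hA0 : 0 ≤ A := (ha 0).trans (hA 0)
        calc _ ≤ ∑ i : Fin n, H ^ 2 / 12 * A * ∑ l : S, x i l.1 ^ 2 := by
              refine Finset.sum_le_sum fun i _ => ?_
              simp only [w, c, Sum.elim_inl, dotProduct, ← pow_two]
              have h0 : 0 ≤ ∑ l : S, x i l.1 ^ 2 := Finset.sum_nonneg fun _ _ => sq_nonneg _
              have h1 := hA (∑ j, x i j * u j)
              calc _ = H ^ 2 / 12 * a (∑ j, x i j * u j) * ∑ l : S, x i l.1 ^ 2 := by ring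
                _ ≤ _ := by gcongr
          _ = H ^ 2 / 12 * A * ∑ l : S, ∑ i, x i l.1 ^ 2 := by
              rw [← Finset.mul_sum, Finset.sum_comm]
          _ ≤ H ^ 2 / 12 * A * ∑ _l : S, T := by gcongr with l _; exact hT l.1
          _ = _ := by simp; ring
      calc _ = ∑ i : Fin n, w (.inl i) * (c (.inl i) ⬝ᵥ z₀) ^ 2
          + ∑ i : Fin n, w (.inl i) * (c (.inl i) ⬝ᵥ c (.inl i) / 12) := by
            rw [← Finset.sum_add_distrib]; exact Finset.sum_congr rfl fun i _ => by ring
        _ ≤ _ := add_le_add f1 f2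
    have e2 : ∑ l : S, w (.inr l) * ((c (.inr l) ⬝ᵥ z₀) ^ 2 + c (.inr l) ⬝ᵥ c (.inr l) / 12)
        = κ * ((1 + η) ^ 2 + H ^ 2 / 12 * S.card) := by
      simp only [w, c, Sum.elim_inr, single_dotProduct, Pi.single_eq_same, one_mul]
      rw [← Finset.mul_sum, Finset.sum_add_distrib]
      have : ∑ l, z₀ l ^ 2 = ((1 + η) / H) ^ 2 := by
        have : ∑ l, z₀ l ^ 2 = z₀ ⬝ᵥ z₀ := by simp [dotProduct, pow_two]
        rw [this, hz₀, smul_dotProduct, dotProduct_smul, hv]; simp [pow_two]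
      rw [this]
      simp
      field_simp
    rw [Fintype.sum_sum_type, e2]
    linarith
  rw [pi_unifCentered] at hjen
  calc _ ≤ ENNReal.ofReal (rexp (∑ i, ψ (x i ⬝ᵥ u))) * ENNReal.ofReal
        (rexp (-(1 / 2) * ∑ r, w r * ((c r ⬝ᵥ z₀) ^ 2 + c r ⬝ᵥ c r / 12))) := by
        rw [← ENNReal.ofReal_mul (Real.exp_pos _).le, ← Real.exp_add]
        gcongr
        linarith
    _ ≤ ENNReal.ofReal (rexp (∑ i, ψ (x i ⬝ᵥ u))) *
        ∫⁻ s in (Set.pi Set.univ fun _ : S => Set.Icc (-(1 / 2) : ℝ) (1 / 2)),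
          ENNReal.ofReal (rexp (-(1 / 2) * ∑ r, w r * (c r ⬝ᵥ (z₀ + s)) ^ 2)) := by gcongr
    _ = ∫⁻ s in (Set.pi Set.univ fun _ : S => Set.Icc (-(1 / 2) : ℝ) (1 / 2)),
          laplaceDensity S u a ψ κ H x (z₀ + s) := by
        rw [← lintegral_const_mul]
        · refine setLIntegral_congr_fun (MeasurableSet.univ_pi fun _ => measurableSet_Icc)
            fun s hs => ?_
          rw [laplaceDensity, Set.indicator_of_mem (by exact hbox s hs), hexp,
            ← ENNReal.ofReal_mul (Real.exp_pos _).le, ← Real.exp_add]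
        · simp only [dotProduct]; fun_prop
    _ ≤ ∫⁻ s, laplaceDensity S u a ψ κ H x (z₀ + s) := setLIntegral_le_lintegral _ _
    _ = _ := lintegral_add_left_eq_self _ _

/-- Lower tail bound for the smallest eigenvalue of a weighted Gram matrix. -/
theorem gaussMat_small_quadratic_le (hu : u ⬝ᵥ u = 1) (ham : Measurable a) (hψm : Measurable ψ)
    (ha : ∀ g, 0 ≤ a g)
    (h : ∀ g, (a g = 0 ∧ ψ g = 0) ∨
      ∃ τ > 0, τ ≤ g ∧ rexp (2 * ψ g) * rexp (τ ^ 2 - 1) ≤ τ ^ 2 * (1 + a g))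
    (hκ : 0 < κ) (hH : 0 < H) {A N T B η : ℝ}
    (hA : ∀ g, a g ≤ A) (hη : 0 ≤ η) (hηH : H ^ 2 * S.card / 4 ≤ η ^ 2) :
    gaussMat n p {x | B ≤ ∑ i, ψ (x i ⬝ᵥ u) ∧ (∀ j, ∑ i, x i j ^ 2 ≤ T) ∧
      ∃ v : S → ℝ, v ⬝ᵥ v = 1 ∧ ∑ i, a (x i ⬝ᵥ u) * (x i ⬝ᵥ extendVec S v) ^ 2 ≤ N}
    ≤ ENNReal.ofReal (√(π / (κ * H ^ 2 / 2)) ^ S.card *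
      rexp (1 / 2 * ((1 + η) ^ 2 * N + H ^ 2 / 12 * A * T * S.card
      + κ * ((1 + η) ^ 2 + H ^ 2 / 12 * S.card)) - B)) := by
  set E := B - 1 / 2 * ((1 + η) ^ 2 * N + H ^ 2 / 12 * A * T * S.card
      + κ * ((1 + η) ^ 2 + H ^ 2 / 12 * S.card)) with hE
  have hI : Measurable fun x : Fin n → Fin p → ℝ => ∫⁻ z, laplaceDensity S u a ψ κ H x z :=
    (measurable_laplaceDensity S u κ H ham hψm).lintegral_prod_right'
  have hmk := mul_meas_ge_le_lintegral (μ := gaussMat n p) hI (ENNReal.ofReal (rexp E))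
  have hup := hmk.trans (lintegral_laplace_le S u κ H hu ham hψm ha h hκ hH)
  have hsub : {x : Fin n → Fin p → ℝ | B ≤ ∑ i, ψ (x i ⬝ᵥ u) ∧ (∀ j, ∑ i, x i j ^ 2 ≤ T) ∧
      ∃ v : S → ℝ, v ⬝ᵥ v = 1 ∧ ∑ i, a (x i ⬝ᵥ u) * (x i ⬝ᵥ extendVec S v) ^ 2 ≤ N}
      ⊆ {x | ENNReal.ofReal (rexp E) ≤ ∫⁻ z, laplaceDensity S u a ψ κ H x z} := by
    rintro x ⟨hB, hT, v, hv, hN⟩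
    exact le_lintegral_laplace S u κ H ha hκ hH hA hη hηH x hB hT v hv hN
  have h0 : ENNReal.ofReal (rexp E) ≠ 0 := by simp [Real.exp_pos]
  rw [mul_comm, ← ENNReal.le_div_iff_mul_le (Or.inl h0) (Or.inl ENNReal.ofReal_ne_top),
    ← ENNReal.ofReal_div_of_pos (Real.exp_pos _), div_eq_mul_inv, ← Real.exp_neg] at hup
  refine (measure_mono hsub).trans (hup.trans (le_of_eq ?_))
  rw [hE]; ring_nf

end

section

variable {n p : ℕ} {S : Finset (Fin p)} {w : Fin n → ℝ} {x : Fin n → Fin p → ℝ}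

theorem dotProduct_gramW_mulVec (z : S → ℝ) :
    z ⬝ᵥ (gramW S w x *ᵥ z) = ∑ i, w i * ((fun l : S => x i l.1) ⬝ᵥ z) ^ 2 := by
  have h1 (i : Fin n) : w i * ((fun l : S => x i l.1) ⬝ᵥ z) ^ 2
      = ∑ j : S, ∑ k : S, z j * (w i * x i j.1 * x i k.1 * z k) := by
    rw [pow_two, dotProduct, Finset.sum_mul_sum, Finset.mul_sum]
    refine Finset.sum_congr rfl fun j _ => ?_
    rw [Finset.mul_sum]
    exact Finset.sum_congr rfl fun k _ => by ring
  simp_rw [h1, dotProduct, mulVec, dotProduct, gramW, of_apply, Finset.mul_sum, Finset.sum_mul,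
    Finset.mul_sum]
  rw [Finset.sum_comm (s := (Finset.univ : Finset (Fin n)))]
  refine Finset.sum_congr rfl fun j _ => ?_
  rw [Finset.sum_comm]

theorem gramW_posDef {m : ℝ} (hm : 0 < m)
    (h : ∀ z : S → ℝ, m * (z ⬝ᵥ z) ≤ ∑ i, w i * ((fun l : S => x i l.1) ⬝ᵥ z) ^ 2) :
    (gramW S w x).PosDef := by
  refine PosDef.of_dotProduct_mulVec_pos ?_ fun z hz => ?_
  · ext j k
    simp only [gramW, conjTranspose_apply, of_apply, star_trivial]
    exact Finset.sum_congr rfl fun i _ => by ring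
  · rw [star_trivial, dotProduct_gramW_mulVec]
    have : 0 < z ⬝ᵥ z := by
      have := dotProduct_star_self_pos_iff.2 hz
      simpa using this
    exact (mul_pos hm this).trans_le (h z)

theorem dotProduct_gramW_inv_le {m C : ℝ} (hm : 0 < m)
    (h : ∀ z : S → ℝ, m * (z ⬝ᵥ z) ≤ ∑ i, w i * ((fun l : S => x i l.1) ⬝ᵥ z) ^ 2)
    (y : S → ℝ) (hy : y ⬝ᵥ y ≤ C) :
    y ⬝ᵥ ((gramW S w x)⁻¹ *ᵥ y) ≤ C / m := by
  have hpd := gramW_posDef hm h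
  set z := (gramW S w x)⁻¹ *ᵥ y with hz
  have hyz : gramW S w x *ᵥ z = y := by
    rw [hz, mulVec_mulVec, mul_nonsing_inv _ ((isUnit_iff_isUnit_det _).1 hpd.isUnit), one_mulVec]
  have h1 := h z
  rw [← dotProduct_gramW_mulVec, hyz, dotProduct_comm z y] at h1
  have h2 : (y ⬝ᵥ z) ^ 2 ≤ (y ⬝ᵥ y) * (z ⬝ᵥ z) := by
    have := Finset.sum_mul_sq_le_sq_mul_sq Finset.univ y z
    simpa [dotProduct, pow_two] using this
  have h3 : 0 ≤ z ⬝ᵥ z := Finset.sum_nonneg fun _ _ => mul_self_nonneg _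
  have h4 : 0 ≤ y ⬝ᵥ z := (mul_nonneg hm.le h3).trans h1
  have hC : 0 ≤ C := (Finset.sum_nonneg fun _ _ => mul_self_nonneg _).trans hy
  rw [le_div_iff₀ hm]
  rcases h4.eq_or_lt with h5 | h5
  · rw [← h5]; simpa using hC
  · have : (y ⬝ᵥ z) * (y ⬝ᵥ z * m) ≤ (y ⬝ᵥ z) * C := by
      calc _ = m * (y ⬝ᵥ z) ^ 2 := by ring
        _ ≤ m * (C * (z ⬝ᵥ z)) := by gcongr; exact h2.trans (by gcongr)
        _ = C * (m * (z ⬝ᵥ z)) := by ring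
        _ ≤ C * (y ⬝ᵥ z) := by gcongr
        _ = _ := mul_comm _ _
    exact le_of_mul_le_mul_left this h5

/-- A lower bound on unit vectors supported on `S'` gives one for all vectors supported on
`S ⊆ S'`. -/
theorem quadratic_lower_of_superset {S' : Finset (Fin p)} (hS : S ⊆ S') {L m : ℝ} {ω : Fin n → ℝ}
    (hL : 0 ≤ L) (hw : ∀ i, L * ω i ≤ w i)
    (h : ∀ v : S' → ℝ, v ⬝ᵥ v = 1 → m ≤ ∑ i, ω i * (x i ⬝ᵥ extendVec S' v) ^ 2) (z : S → ℝ) :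
    L * m * (z ⬝ᵥ z) ≤ ∑ i, w i * ((fun l : S => x i l.1) ⬝ᵥ z) ^ 2 := by
  have hzz : 0 ≤ z ⬝ᵥ z := Finset.sum_nonneg fun _ _ => mul_self_nonneg _
  rcases hzz.eq_or_lt with h0 | h0
  · have : z = 0 := dotProduct_self_eq_zero.1 h0.symm
    simp [this]
  set r := √(z ⬝ᵥ z) with hr
  have hr0 : 0 < r := Real.sqrt_pos.2 h0
  have hr2 : r ^ 2 = z ⬝ᵥ z := Real.sq_sqrt hzz
  let v : S' → ℝ := fun l => r⁻¹ * extendVec S z l.1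
  have hext : extendVec S' v = r⁻¹ • extendVec S z := by
    ext j
    by_cases hj : j ∈ S'
    · simp [extendVec, hj, v]
    · have : j ∉ S := fun h => hj (hS h)
      simp [extendVec, hj, this]
  have hv : v ⬝ᵥ v = 1 := by
    rw [← extendVec_dotProduct_self, hext, smul_dotProduct, dotProduct_smul,
      extendVec_dotProduct_self, ← hr2]
    simp; field_simp
  have h1 := h v hv
  simp_rw [hext, dotProduct_smul, dotProduct_extendVec, smul_eq_mul] at h1
  have h2 : ∑ i, ω i * (r⁻¹ * (fun l : S => x i l.1) ⬝ᵥ z) ^ 2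
      = (z ⬝ᵥ z)⁻¹ * ∑ i, ω i * ((fun l : S => x i l.1) ⬝ᵥ z) ^ 2 := by
    rw [Finset.mul_sum, ← hr2]
    exact Finset.sum_congr rfl fun i _ => by ring
  rw [h2, le_inv_mul_iff₀ h0] at h1
  calc L * m * (z ⬝ᵥ z) = L * (z ⬝ᵥ z * m) := by ring
    _ ≤ L * ∑ i, ω i * ((fun l : S => x i l.1) ⬝ᵥ z) ^ 2 := by gcongr
    _ = ∑ i, L * ω i * ((fun l : S => x i l.1) ⬝ᵥ z) ^ 2 := by
      rw [Finset.mul_sum]; exact Finset.sum_congr rfl fun i _ => by ring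
    _ ≤ _ := by gcongr with i _; exact hw i

end

theorem gaussianReal_sq_gt_le {t : ℝ} (ht : 0 ≤ t) :
    gaussianReal 0 1 {y | t < y ^ 2} ≤ ENNReal.ofReal (2 * rexp (-(t / 2))) := by
  set r := √t with hr
  have hr2 : r ^ 2 = t := Real.sq_sqrt ht
  have hr0 : 0 ≤ r := Real.sqrt_nonneg t
  have h1 := measure_ge_le_exp_mul_mgf (μ := gaussianReal 0 1) (X := id) r hr0
    (by simpa using integrable_exp_mul_gaussianReal r)
  have h2 := measure_le_le_exp_mul_mgf (μ := gaussianReal 0 1) (X := id) (-r)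
    (neg_nonpos.2 hr0) (by simpa using integrable_exp_mul_gaussianReal (-r))
  rw [mgf_id_gaussianReal, ← Real.exp_add] at h1 h2
  have e1 : -r * r + (0 * r + ((1 : NNReal) : ℝ) * r ^ 2 / 2) = -(t / 2) := by
    rw [← hr2]; push_cast; ring
  have e2 : - -r * -r + (0 * -r + ((1 : NNReal) : ℝ) * (-r) ^ 2 / 2) = -(t / 2) := by
    rw [← hr2]; push_cast; ring
  rw [e1] at h1
  rw [e2] at h2
  have hsub : {y : ℝ | t < y ^ 2} ⊆ {y | r ≤ id y} ∪ {y | id y ≤ -r} := by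
    intro y hy
    by_contra hcon
    simp only [Set.mem_union, Set.mem_ofPred_eq, id, not_or, not_le] at hcon hy
    nlinarith [hcon.1, hcon.2]
  rw [two_mul, ENNReal.ofReal_add (Real.exp_pos _).le (Real.exp_pos _).le]
  refine (measure_mono hsub).trans ((measure_union_le _ _).trans (add_le_add ?_ ?_))
  · exact (ENNReal.le_ofReal_iff_toReal_le (measure_ne_top _ _) (Real.exp_pos _).le).2 h1
  · exact (ENNReal.le_ofReal_iff_toReal_le (measure_ne_top _ _) (Real.exp_pos _).le).2 h2

theorem gaussMat_entry_sq_gt_le {n p : ℕ} {t : ℝ} (ht : 0 ≤ t) (i : Fin n) (j : Fin p) :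
    gaussMat n p {x | t < x i j ^ 2} ≤ ENNReal.ofReal (2 * rexp (-(t / 2))) := by
  have h1 := measurePreserving_eval
    (fun _ : Fin n => Measure.pi fun _ : Fin p => gaussianReal 0 1) i
  have h2 := measurePreserving_eval (fun _ : Fin p => gaussianReal 0 1) j
  have hm : MeasurableSet {y : ℝ | t < y ^ 2} := measurableSet_lt measurable_const (by fun_prop)
  have := (h2.comp h1).measure_preimage hm.nullMeasurableSet
  rw [gaussMat]
  refine le_of_eq_of_le ?_ (gaussianReal_sq_gt_le ht)
  rw [← this]; rfl

theorem lintegral_exp_sq_div_three :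
    ∫⁻ y, ENNReal.ofReal (rexp (y ^ 2 / 3)) ∂(gaussianReal 0 1) = ENNReal.ofReal √3 := by
  rw [gaussianReal_of_var_ne_zero 0 one_ne_zero,
    lintegral_withDensity_eq_lintegral_mul _ (measurable_gaussianPDF 0 1) (by fun_prop)]
  have h1 (y : ℝ) : (gaussianPDF 0 1 * fun y => ENNReal.ofReal (rexp (y ^ 2 / 3))) y
      = ENNReal.ofReal ((√(2 * π))⁻¹ * rexp (-(1 / 6) * y ^ 2)) := by
    rw [Pi.mul_apply, gaussianPDF, gaussianPDFReal, ← ENNReal.ofReal_mul (by positivity),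
      mul_assoc, ← Real.exp_add]
    congr 3
    · simp
    · push_cast; ring
  simp_rw [h1]
  rw [← ofReal_integral_eq_lintegral_ofReal
    ((integrable_exp_neg_mul_sq (by norm_num)).const_mul _) (ae_of_all _ fun _ => by positivity),
    integral_const_mul, integral_gaussian, ← Real.sqrt_inv, ← Real.sqrt_mul (by positivity)]
  congr 2
  field_simp
  norm_num

theorem gaussMat_column_gt_le {n p : ℕ} (j : Fin p) :
    gaussMat n p {x | 3 * (n : ℝ) < ∑ i, x i j ^ 2} ≤ ENNReal.ofReal ((√3 * rexp (-1)) ^ n) := by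
  let f : (Fin p → ℝ) → ENNReal := fun y => ENNReal.ofReal (rexp (y j ^ 2 / 3))
  have hf : Measurable f := by fun_prop
  have hmk := mul_meas_ge_le_lintegral (μ := gaussMat n p) (f := fun x => ∏ i, f (x i))
    (by fun_prop) (ENNReal.ofReal (rexp n))
  have hrow : ∫⁻ y, f y ∂(Measure.pi fun _ : Fin p => gaussianReal 0 1) = ENNReal.ofReal √3 := by
    rw [← lintegral_exp_sq_div_three]
    exact (measurePreserving_eval (fun _ : Fin p => gaussianReal 0 1) j).lintegral_comp
      (f := fun y => ENNReal.ofReal (rexp (y ^ 2 / 3))) (by fun_prop)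
  have hint : ∫⁻ x, ∏ i, f (x i) ∂(gaussMat n p) = ENNReal.ofReal (√3 ^ n) := by
    rw [gaussMat, lintegral_pi_prod _ (fun _ => f) (fun _ => hf), hrow]
    simp [ENNReal.ofReal_pow]
  rw [hint, mul_comm, ← ENNReal.le_div_iff_mul_le (Or.inl (by simp [Real.exp_pos]))
    (Or.inl ENNReal.ofReal_ne_top), ← ENNReal.ofReal_div_of_pos (Real.exp_pos _)] at hmk
  refine (measure_mono ?_).trans (hmk.trans (le_of_eq ?_))
  · intro x hx
    simp only [Set.mem_ofPred_eq, f] at hx ⊢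
    rw [← ENNReal.ofReal_prod_of_nonneg fun _ _ => (Real.exp_pos _).le, ← Real.exp_sum]
    gcongr
    rw [← Finset.sum_div]; linarith
  · rw [mul_pow, ← Real.exp_nat_mul, div_eq_mul_inv, ← Real.exp_neg]
    simp

theorem exp_neg_le_quadratic {x : ℝ} (hx : 0 ≤ x) : rexp (-x) ≤ 1 - x + x ^ 2 / 2 := by
  have h := Real.quadratic_le_exp_of_nonneg hx
  rw [Real.exp_neg, inv_le_iff_one_le_mul₀ (Real.exp_pos x)]
  calc (1 : ℝ) ≤ (1 - x + x ^ 2 / 2) * (1 + x + x ^ 2 / 2) := by nlinarith [sq_nonneg (x ^ 2)]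
    _ ≤ _ := by
      gcongr
      nlinarith [sq_nonneg (x - 1)]

theorem gaussianReal_Ici_zero : (gaussianReal 0 1).real (Set.Ici 0) = 1 / 2 := by
  have hsymm : (gaussianReal 0 1).real (Set.Iic 0) = (gaussianReal 0 1).real (Set.Ici 0) := by
    have h := gaussianReal_map_neg (μ := 0) (v := 1)
    rw [neg_zero] at h
    have h2 : (Measure.map (fun x : ℝ => -x) (gaussianReal 0 1)).real (Set.Iic 0)
        = (gaussianReal 0 1).real (Set.Ici 0) := by
      rw [map_measureReal_apply (by fun_prop) measurableSet_Iic]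
      congr 1; ext y; simp
    rw [← h2, h]
  have := nullSingletonClass_gaussianReal (μ := 0) (one_ne_zero (α := NNReal))
  have h3 : (gaussianReal 0 1).real (Set.Iio 0) = (gaussianReal 0 1).real (Set.Iic 0) :=
    measureReal_congr Iio_ae_eq_Iic
  have h4 := probReal_add_probReal_compl (μ := gaussianReal 0 1)
    (measurableSet_Ici (a := (0 : ℝ)))
  rw [Set.compl_Ici, h3, hsymm] at h4
  linarith

theorem le_gaussianReal_Ici {τ : ℝ} (hτ : 0 ≤ τ) :
    1 / 2 - (√(2 * π))⁻¹ * (τ - τ ^ 3 / 6 + τ ^ 5 / 40) ≤ (gaussianReal 0 1).real (Set.Ici τ) := by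
  have h1 : (gaussianReal 0 1).real (Set.Ici 0)
      ≤ (gaussianReal 0 1).real (Set.Ioc 0 τ) + (gaussianReal 0 1).real (Set.Ici τ) := by
    have := nullSingletonClass_gaussianReal (μ := 0) (one_ne_zero (α := NNReal))
    have h2 : (gaussianReal 0 1).real (Set.Ici 0) = (gaussianReal 0 1).real (Set.Ioi 0) :=
      measureReal_congr Ioi_ae_eq_Ici.symm
    rw [h2]
    refine (measureReal_mono ?_).trans (measureReal_union_le _ _)
    intro y hy
    rcases le_total y τ with h | h
    · exact Or.inl ⟨hy, h⟩
    · exact Or.inr h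
  rw [gaussianReal_Ici_zero] at h1
  have h2 : (gaussianReal 0 1).real (Set.Ioc 0 τ)
      ≤ (√(2 * π))⁻¹ * (τ - τ ^ 3 / 6 + τ ^ 5 / 40) := by
    rw [measureReal_def, gaussianReal_apply_eq_integral 0 one_ne_zero,
      ENNReal.toReal_ofReal (integral_nonneg fun _ => gaussianPDFReal_nonneg _ _ _),
      ← intervalIntegral.integral_of_le hτ]
    have h3 : ∫ y in (0 : ℝ)..τ, (√(2 * π))⁻¹ * (1 - y ^ 2 / 2 + y ^ 4 / 8)
        = (√(2 * π))⁻¹ * (τ - τ ^ 3 / 6 + τ ^ 5 / 40) := by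
      rw [intervalIntegral.integral_const_mul, intervalIntegral.integral_add,
        intervalIntegral.integral_sub, intervalIntegral.integral_div, intervalIntegral.integral_div,
        integral_pow, integral_pow, integral_one]
      · ring
      all_goals exact Continuous.intervalIntegrable (by fun_prop) _ _
    rw [← h3]
    refine intervalIntegral.integral_mono_on hτ ?_ ?_ fun y _ => ?_
    · exact (integrable_gaussianPDFReal 0 1).intervalIntegrable
    · exact Continuous.intervalIntegrable (by fun_prop) _ _
    · rw [gaussianPDFReal]
      have h4 := exp_neg_le_quadratic (x := y ^ 2 / 2) (by positivity)
      have h5 : -(y - 0) ^ 2 / (2 * ((1 : NNReal) : ℝ)) = -(y ^ 2 / 2) := by push_cast; ring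
      rw [h5]
      simp only [NNReal.coe_one, mul_one]
      gcongr
      linarith
  linarith

theorem inv_sqrt_two_pi_le : (√(2 * π))⁻¹ ≤ 0.39895 := by
  rw [inv_le_comm₀ (by positivity) (by norm_num)]
  refine Real.le_sqrt_of_sq_le ?_
  have := Real.pi_gt_d4
  norm_num; linarith

/-- Number of thresholds below `y`. -/
noncomputable def thresholdCount (y : ℝ) : ℝ :=
  (Set.Ici 0.495).indicator 1 y + (Set.Ici 0.637).indicator 1 y
    + (Set.Ici 0.778).indicator 1 y + (Set.Ici 0.92).indicator 1 y

theorem measurable_thresholdCount : Measurable thresholdCount := by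
  unfold thresholdCount
  have h (a : ℝ) : Measurable ((Set.Ici a).indicator (1 : ℝ → ℝ)) :=
    measurable_one.indicator measurableSet_Ici
  exact (((h _).add (h _)).add (h _)).add (h _)

theorem thresholdCount_cases (y : ℝ) :
    (y < 0.495 ∧ thresholdCount y = 0) ∨ (0.495 ≤ y ∧ y < 0.637 ∧ thresholdCount y = 1) ∨
      (0.637 ≤ y ∧ y < 0.778 ∧ thresholdCount y = 2) ∨
      (0.778 ≤ y ∧ y < 0.92 ∧ thresholdCount y = 3) ∨ (0.92 ≤ y ∧ thresholdCount y = 4) := by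
  unfold thresholdCount
  simp only [Set.indicator_apply, Set.mem_Ici, Pi.one_apply]
  rcases lt_or_ge y 0.495 with h1 | h1
  · left
    rw [if_neg (by linarith), if_neg (by linarith), if_neg (by linarith), if_neg (by linarith)]
    exact ⟨h1, by norm_num⟩
  right
  rcases lt_or_ge y 0.637 with h2 | h2
  · left
    rw [if_pos (by linarith), if_neg (by linarith), if_neg (by linarith), if_neg (by linarith)]
    exact ⟨h1, h2, by norm_num⟩
  right
  rcases lt_or_ge y 0.778 with h3 | h3
  · left
    rw [if_pos (by linarith), if_pos (by linarith), if_neg (by linarith), if_neg (by linarith)]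
    exact ⟨h2, h3, by norm_num⟩
  right
  rcases lt_or_ge y 0.92 with h4 | h4
  · left
    rw [if_pos (by linarith), if_pos (by linarith), if_pos (by linarith), if_neg (by linarith)]
    exact ⟨h3, h4, by norm_num⟩
  right
  rw [if_pos (by linarith), if_pos (by linarith), if_pos (by linarith), if_pos (by linarith)]
  exact ⟨h4, by norm_num⟩

theorem exp_neg_thresholdCount (y : ℝ) :
    rexp (-(Real.log (15 / 14) * thresholdCount y))
      = 1 - 1 / 15 * ((Set.Ici 0.495).indicator 1 y + 14 / 15 * (Set.Ici 0.637).indicator 1 y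
        + (14 / 15) ^ 2 * (Set.Ici 0.778).indicator 1 y
        + (14 / 15) ^ 3 * (Set.Ici 0.92).indicator 1 y) := by
  have hs : rexp (-Real.log (15 / 14)) = 14 / 15 := by
    rw [Real.exp_neg, Real.exp_log (by norm_num)]; norm_num
  have hpow (k : ℕ) : rexp (-(Real.log (15 / 14) * k)) = (14 / 15) ^ k := by
    rw [← hs, ← Real.exp_nat_mul]; ring_nf
  have p0 := hpow 0
  have p1 := hpow 1
  have p2 := hpow 2
  have p3 := hpow 3
  have p4 := hpow 4
  push_cast at p0 p1 p2 p3 p4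
  simp only [Set.indicator_apply, Set.mem_Ici, Pi.one_apply]
  rcases thresholdCount_cases y with ⟨h, e⟩ | ⟨h, h', e⟩ | ⟨h, h', e⟩ | ⟨h, h', e⟩ | ⟨h, e⟩
  · rw [e, p0, if_neg (by linarith), if_neg (by linarith), if_neg (by linarith),
      if_neg (by linarith)]
    norm_num
  · rw [e, p1, if_pos (by linarith), if_neg (by linarith), if_neg (by linarith),
      if_neg (by linarith)]
    norm_num
  · rw [e, p2, if_pos (by linarith), if_pos (by linarith), if_neg (by linarith),
      if_neg (by linarith)]
    norm_num
  · rw [e, p3, if_pos (by linarith), if_pos (by linarith), if_pos (by linarith),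
      if_neg (by linarith)]
    norm_num
  · rw [e, p4, if_pos (by linarith), if_pos (by linarith), if_pos (by linarith),
      if_pos (by linarith)]
    norm_num

theorem integral_exp_neg_thresholdCount_le :
    ∫ y, rexp (-(Real.log (15 / 14) * thresholdCount y)) ∂(gaussianReal 0 1) ≤ 0.941 := by
  simp_rw [exp_neg_thresholdCount]
  have hI (a c : ℝ) : Integrable (fun y => c * (Set.Ici a).indicator (1 : ℝ → ℝ) y)
      (gaussianReal 0 1) :=
    ((integrable_const (1 : ℝ)).indicator measurableSet_Ici).const_mul c
  have hI1 (a : ℝ) : Integrable (fun y => (Set.Ici a).indicator (1 : ℝ → ℝ) y)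
      (gaussianReal 0 1) :=
    (integrable_const (1 : ℝ)).indicator measurableSet_Ici
  have hv (a : ℝ) : ∫ y, (Set.Ici a).indicator (1 : ℝ → ℝ) y ∂(gaussianReal 0 1)
      = (gaussianReal 0 1).real (Set.Ici a) := integral_indicator_one measurableSet_Ici
  have h12 := (hI1 0.495).fun_add (hI 0.637 (14 / 15))
  have h123 := h12.fun_add (hI 0.778 ((14 / 15) ^ 2))
  have h1234 := h123.fun_add (hI 0.92 ((14 / 15) ^ 3))
  rw [integral_sub (integrable_const _) (h1234.const_mul _), integral_const_mul,
    integral_add h123 (hI _ _), integral_add h12 (hI _ _), integral_add (hI1 _) (hI _ _),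
    integral_const_mul, integral_const_mul, integral_const_mul, hv, hv, hv, hv]
  have hq (τ q : ℝ) (hτ : 0 ≤ τ - τ ^ 3 / 6 + τ ^ 5 / 40) (hτ0 : 0 ≤ τ)
      (h : q ≤ 1 / 2 - 0.39895 * (τ - τ ^ 3 / 6 + τ ^ 5 / 40)) :
      q ≤ (gaussianReal 0 1).real (Set.Ici τ) := by
    refine h.trans (le_trans ?_ (le_gaussianReal_Ici hτ0))
    have := inv_sqrt_two_pi_le
    gcongr
  have q1 := hq 0.495 0.3102 (by norm_num) (by norm_num) (by norm_num)
  have q2 := hq 0.637 0.2620 (by norm_num) (by norm_num) (by norm_num)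
  have q3 := hq 0.778 0.2180 (by norm_num) (by norm_num) (by norm_num)
  have q4 := hq 0.92 0.1781 (by norm_num) (by norm_num) (by norm_num)
  simp only [integral_const, probReal_univ, smul_eq_mul]
  linarith

theorem log_fifteen_div_fourteen_le : Real.log (15 / 14) ≤ 0.069 := by
  rw [Real.log_le_iff_le_exp (by norm_num)]
  have := Real.sum_le_exp_of_nonneg (x := 0.069) (by norm_num) 4
  refine le_trans ?_ this
  simp [Finset.sum_range_succ, Nat.factorial]; norm_num

/-- The threshold counts of the linear predictor are rarely small. -/
theorem gaussMat_thresholdCount_lt_le {n p : ℕ} (u : Fin p → ℝ) (hu : u ⬝ᵥ u = 1) :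
    gaussMat n p {x | ∑ i, thresholdCount (x i ⬝ᵥ u) < 0.575 * n + 21.5}
      ≤ ENNReal.ofReal (4.5 * rexp (-(n : ℝ) / 48)) := by
  set c := Real.log (15 / 14) with hc
  have hc0 : 0 ≤ c := Real.log_nonneg (by norm_num)
  set B : ℝ := 0.575 * n + 21.5 with hB
  let f : ℝ → ENNReal := fun y => ENNReal.ofReal (rexp (-(c * thresholdCount y)))
  have hf : Measurable f := by
    have := measurable_thresholdCount
    fun_prop
  have hfu : Measurable fun y : Fin p → ℝ => f (y ⬝ᵥ u) :=
    hf.comp (by simp only [dotProduct]; fun_prop)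
  have hmk := mul_meas_ge_le_lintegral (μ := gaussMat n p) (f := fun x => ∏ i, f (x i ⬝ᵥ u))
    (Finset.measurable_fun_prod _ fun i _ => hfu.comp (measurable_pi_apply i))
    (ENNReal.ofReal (rexp (-(c * B))))
  have hrow : ∫⁻ y, f (y ⬝ᵥ u) ∂(Measure.pi fun _ : Fin p => gaussianReal 0 1)
      ≤ ENNReal.ofReal 0.941 := by
    rw [← lintegral_map hf (by simp only [dotProduct]; fun_prop), map_dotProduct, hu,
      Real.toNNReal_one, ← ofReal_integral_eq_lintegral_ofReal _
        (ae_of_all _ fun _ => (Real.exp_pos _).le)]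
    · exact ENNReal.ofReal_le_ofReal integral_exp_neg_thresholdCount_le
    · refine Integrable.of_bound (C := 1) ?_ (ae_of_all _ fun y => ?_)
      · have := measurable_thresholdCount
        fun_prop
      · rw [Real.norm_eq_abs, Real.abs_exp, Real.exp_le_one_iff]
        have : 0 ≤ thresholdCount y := by
          rcases thresholdCount_cases y with h | h | h | h | h <;> simp [h]
        have := mul_nonneg hc0 this
        linarith
  have hint : ∫⁻ x, ∏ i, f (x i ⬝ᵥ u) ∂(gaussMat n p) ≤ ENNReal.ofReal (0.941 ^ n) := by
    rw [gaussMat, lintegral_pi_prod _ (fun _ y => f (y ⬝ᵥ u)) (fun _ => hfu),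
      ENNReal.ofReal_pow (by norm_num)]
    simp only [Finset.prod_const, Finset.card_univ, Fintype.card_fin]
    gcongr
  have hfin := hmk.trans hint
  rw [mul_comm, ← ENNReal.le_div_iff_mul_le (Or.inl (by simp [Real.exp_pos]))
    (Or.inl ENNReal.ofReal_ne_top), ← ENNReal.ofReal_div_of_pos (Real.exp_pos _)] at hfin
  refine (measure_mono ?_).trans (hfin.trans (ENNReal.ofReal_le_ofReal ?_))
  · intro x hx
    simp only [Set.mem_ofPred_eq, f] at hx ⊢
    rw [← ENNReal.ofReal_prod_of_nonneg fun _ _ => (Real.exp_pos _).le, ← Real.exp_sum]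
    gcongr
    rw [Finset.sum_neg_distrib, ← Finset.mul_sum]
    gcongr
  · rw [div_eq_mul_inv, ← Real.exp_neg, neg_neg]
    have h1 : (0.941 : ℝ) ≤ rexp (-0.060509) := by
      rw [Real.exp_neg, le_inv_comm₀ (by norm_num) (Real.exp_pos _)]
      have := Real.exp_bound' (x := 0.060509) (by norm_num) (by norm_num) (n := 3) (by norm_num)
      refine this.trans ?_
      simp [Finset.sum_range_succ, Nat.factorial]; norm_num
    have h2 : rexp 1.4835 ≤ 4.5 := by
      have e1 : rexp 1.4835 = rexp 0.4945 ^ 3 := by rw [← Real.exp_nat_mul]; norm_num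
      have := Real.exp_bound' (x := 0.4945) (by norm_num) (by norm_num) (n := 4) (by norm_num)
      have h3 : rexp 0.4945 ≤ 1.6409 := by
        refine this.trans ?_
        simp [Finset.sum_range_succ, Nat.factorial]; norm_num
      rw [e1]
      calc _ ≤ (1.6409 : ℝ) ^ 3 := by gcongr
        _ ≤ _ := by norm_num
    calc (0.941 : ℝ) ^ n * rexp (c * B) ≤ rexp (-0.060509) ^ n * rexp (0.069 * B) := by
          have := log_fifteen_div_fourteen_le
          gcongr
      _ = rexp 1.4835 * rexp (-(0.060509 - 0.069 * 0.575) * n) := by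
          rw [← Real.exp_nat_mul, ← Real.exp_add, ← Real.exp_add, hB]; ring_nf
      _ ≤ 4.5 * rexp (-(n : ℝ) / 48) := by
          gcongr
          have : (0 : ℝ) ≤ n := Nat.cast_nonneg n
          linarith

/-- The step function equal to `exp (0.4 * ℓ * thresholdCount g)` above the lowest threshold and
to zero below it. -/
noncomputable def levelWeight (ℓ g : ℝ) : ℝ :=
  if thresholdCount g = 0 then 0 else rexp (0.4 * ℓ * thresholdCount g)

theorem measurable_levelWeight (ℓ : ℝ) : Measurable (levelWeight ℓ) :=
  Measurable.ite (measurable_thresholdCount (measurableSet_singleton 0)) measurable_const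
    (by have := measurable_thresholdCount; fun_prop)

theorem levelWeight_nonneg (ℓ g : ℝ) : 0 ≤ levelWeight ℓ g := by
  unfold levelWeight
  split_ifs <;> positivity

theorem levelWeight_le {ℓ : ℝ} (hℓ : 0 ≤ ℓ) (g : ℝ) : levelWeight ℓ g ≤ rexp (1.6 * ℓ) := by
  unfold levelWeight
  split_ifs
  · positivity
  · refine Real.exp_le_exp.2 ?_
    rcases thresholdCount_cases g with h | h | h | h | h <;> nlinarith [h]

theorem exp_mul_levelWeight_le {ℓ t : ℝ} (hℓ : 0 ≤ ℓ) (ht : 2 * √2 * ℓ ≤ t) (g : ℝ) :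
    rexp ℓ * levelWeight ℓ g ≤ rexp (g * t) := by
  unfold levelWeight
  have h2 : 1.41421 ≤ √2 := Real.le_sqrt_of_sq_le (by norm_num)
  have key : ∀ τ c : ℝ, 0 ≤ τ → τ ≤ g → 1 + 0.4 * c ≤ τ * (2 * 1.41421) →
      rexp ℓ * rexp (0.4 * ℓ * c) ≤ rexp (g * t) := by
    intro τ c hτ hg hc
    rw [← Real.exp_add]
    gcongr
    calc ℓ + 0.4 * ℓ * c = ℓ * (1 + 0.4 * c) := by ring
      _ ≤ ℓ * (τ * (2 * √2)) := by gcongr; exact hc.trans (by gcongr)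
      _ = τ * (2 * √2 * ℓ) := by ring
      _ ≤ g * t := mul_le_mul hg ht (by positivity) (hτ.trans hg)
  split_ifs with h0
  · simpa using (Real.exp_pos _).le
  · rcases thresholdCount_cases g with h | ⟨h, -, h'⟩ | ⟨h, -, h'⟩ | ⟨h, -, h'⟩ | ⟨h, h'⟩
    · exact absurd h.2 h0
    all_goals rw [h']; exact key _ _ (by norm_num) h (by norm_num)

theorem levelWeight_cases (ℓ g : ℝ) :
    (8 * levelWeight ℓ g = 0 ∧ (0.2 * ℓ + 0.25) * thresholdCount g = 0) ∨
    ∃ τ > 0, τ ≤ g ∧ rexp (2 * ((0.2 * ℓ + 0.25) * thresholdCount g)) * rexp (τ ^ 2 - 1)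
      ≤ τ ^ 2 * (1 + 8 * levelWeight ℓ g) := by
  have key : ∀ (τ c : ℝ) (m : ℕ) (y : ℝ), 0 < τ → τ ≤ g → thresholdCount g = c → c ≠ 0 →
      0.5 * c + (τ ^ 2 - 1) = m - y → 0 ≤ y →
      2.7182818286 ^ m * (1 - y + y ^ 2 / 2) ≤ 8 * τ ^ 2 →
      ∃ τ > 0, τ ≤ g ∧ rexp (2 * ((0.2 * ℓ + 0.25) * thresholdCount g)) * rexp (τ ^ 2 - 1)
      ≤ τ ^ 2 * (1 + 8 * levelWeight ℓ g) := by
    intro τ c m y hτ hg hc hc0 he hy h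
    refine ⟨τ, hτ, hg, ?_⟩
    rw [levelWeight, hc, if_neg hc0]
    have hexp : rexp (0.5 * c + (τ ^ 2 - 1)) ≤ 8 * τ ^ 2 := by
      refine le_trans ?_ h
      rw [he, sub_eq_add_neg, Real.exp_add, ← Real.exp_one_pow]
      gcongr
      · exact Real.exp_one_lt_d9.le
      · exact exp_neg_le_quadratic hy
    calc rexp (2 * ((0.2 * ℓ + 0.25) * c)) * rexp (τ ^ 2 - 1)
        = rexp (0.4 * ℓ * c) * rexp (0.5 * c + (τ ^ 2 - 1)) := by
          rw [← Real.exp_add, ← Real.exp_add]; congr 1; ring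
      _ ≤ rexp (0.4 * ℓ * c) * (8 * τ ^ 2) := by gcongr
      _ ≤ τ ^ 2 * (1 + 8 * rexp (0.4 * ℓ * c)) := by nlinarith [sq_nonneg τ]
  rcases thresholdCount_cases g with h | ⟨h, -, h'⟩ | ⟨h, -, h'⟩ | ⟨h, -, h'⟩ | ⟨h, h'⟩
  · left; simp [levelWeight, h.2]
  · exact .inr <| key _ _ 0 0.254975 (by norm_num) h h' (by norm_num) (by norm_num) (by norm_num)
      (by norm_num)
  · exact .inr <| key _ _ 1 0.594231 (by norm_num) h h' (by norm_num) (by norm_num) (by norm_num)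
      (by norm_num)
  · exact .inr <| key _ _ 2 0.894716 (by norm_num) h h' (by norm_num) (by norm_num) (by norm_num)
      (by norm_num)
  · exact .inr <| key _ _ 2 0.1536 (by norm_num) h h' (by norm_num) (by norm_num) (by norm_num)
      (by norm_num)

theorem log_four_mul_pi_le : log (4 * π) ≤ 2.54 := by
  rw [Real.log_le_iff_le_exp (by positivity)]
  have h1 := Real.exp_one_gt_d9
  have h2 := Real.quadratic_le_exp_of_nonneg (x := 0.27) (by norm_num)
  have h3 : rexp 2.54 = rexp 1 ^ 2 * rexp 0.27 ^ 2 := by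
    rw [← Real.exp_nat_mul, ← Real.exp_nat_mul, ← Real.exp_add]; norm_num
  have h4 := Real.pi_lt_d4
  calc 4 * π ≤ 2.7182818283 ^ 2 * (1 + 0.27 + 0.27 ^ 2 / 2) ^ 2 := by norm_num; linarith
    _ ≤ _ := by rw [h3]; gcongr

theorem gaussMat_small_levelWeight_le {n p : ℕ} (S : Finset (Fin p)) (u : Fin p → ℝ)
    (hu : u ⬝ᵥ u = 1) {ℓ : ℝ} (hℓ : 3 ≤ ℓ) (hS : 0 < S.card) (hn : 8 * S.card ≤ n) :
    gaussMat n p {x | 0.575 * n + 21.5 ≤ ∑ i, thresholdCount (x i ⬝ᵥ u) ∧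
      (∀ j, ∑ i, x i j ^ 2 ≤ 3 * n) ∧ ∃ v : S → ℝ, v ⬝ᵥ v = 1 ∧
        ∑ i, levelWeight ℓ (x i ⬝ᵥ u) * (x i ⬝ᵥ extendVec S v) ^ 2 ≤ n / 72} ≤
    ENNReal.ofReal (rexp (S.card * (2.283 + 0.8 * ℓ + log (n / S.card) / 2) + 0.057 * n
      - (0.2 * ℓ + 0.25) * (0.575 * n + 21.5))) := by
  have hk : (0 : ℝ) < S.card := by exact_mod_cast hS
  have hnk : 8 * (S.card : ℝ) ≤ n := by exact_mod_cast hn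
  have hn0 : (0 : ℝ) < n := by linarith
  set k : ℝ := (S.card : ℝ) with hkdef
  set W := rexp (1.6 * ℓ) with hW
  have hW0 : 0 < W := Real.exp_pos _
  have hWge : 110 ≤ W := by
    have h1 := Real.exp_one_gt_d9
    have h2 := Real.quadratic_le_exp_of_nonneg (x := 0.8) (by norm_num)
    calc (110 : ℝ) ≤ 2.7182818283 ^ 4 * (1 + 0.8 + 0.8 ^ 2 / 2) := by norm_num
      _ ≤ rexp 1 ^ 4 * rexp 0.8 := by gcongr
      _ = rexp 4.8 := by rw [← Real.exp_nat_mul, ← Real.exp_add]; norm_num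
      _ ≤ W := by rw [hW]; gcongr; linarith
  set H := √(1 / (2 * W * n)) with hHdef
  have hH2 : H ^ 2 = 1 / (2 * W * n) := Real.sq_sqrt (by positivity)
  have hH : 0 < H := Real.sqrt_pos.2 (by positivity)
  have hηH : H ^ 2 * k / 4 ≤ 0.012 ^ 2 := by
    rw [hH2, div_mul_eq_mul_div, div_div, div_le_iff₀ (by positivity)]
    nlinarith
  have main := gaussMat_small_quadratic_le (n := n) S u (a := fun g => 8 * levelWeight ℓ g)
    (ψ := fun g => (0.2 * ℓ + 0.25) * thresholdCount g) k H hu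
    ((measurable_levelWeight ℓ).const_mul 8) (measurable_thresholdCount.const_mul _)
    (fun g => mul_nonneg (by norm_num) (levelWeight_nonneg ℓ g)) (levelWeight_cases ℓ) hk hH
    (A := 8 * W) (N := 8 * (n / 72)) (T := 3 * n)
    (B := (0.2 * ℓ + 0.25) * (0.575 * n + 21.5)) (η := 0.012)
    (fun g => by
      have := levelWeight_le (by linarith : 0 ≤ ℓ) g
      linarith) (by norm_num) hηH
  refine (measure_mono ?_).trans (main.trans ?_)
  · rintro x ⟨h1, h2, v, hv, h3⟩
    refine ⟨?_, h2, v, hv, ?_⟩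
    · rw [← Finset.mul_sum]
      exact mul_le_mul_of_nonneg_left h1 (by linarith)
    · simp_rw [mul_assoc]
      rw [← Finset.mul_sum]
      linarith
  · refine ENNReal.ofReal_le_ofReal ?_
    have hsqrt : √(π / (k * H ^ 2 / 2)) ^ S.card
        ≤ rexp (k * (1.27 + 0.8 * ℓ + log (n / k) / 2)) := by
      refine le_of_le_of_eq ?_ (Real.exp_nat_mul _ _).symm
      gcongr
      rw [hH2]
      have e : π / (k * (1 / (2 * W * n)) / 2) = (4 * π) * W * (n / k) := by field_simp; ring
      rw [e, ← Real.exp_log (show 0 < (4 * π) * W * (n / k) by positivity), ← Real.exp_half,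
        Real.log_mul (by positivity) (by positivity), Real.log_mul (by positivity) (by positivity),
        hW, Real.log_exp]
      gcongr
      linarith [log_four_mul_pi_le]
    refine (mul_le_mul_of_nonneg_right hsqrt (Real.exp_pos _).le).trans ?_
    rw [← Real.exp_add]
    gcongr
    have e1 : H ^ 2 / 12 * (8 * W) * (3 * n) * k = k := by rw [hH2]; field_simp; ring
    have e2 : H ^ 2 / 12 * k ≤ 0.012 ^ 2 / 3 := by linarith
    have e3 : k * ((1 + 0.012) ^ 2 + H ^ 2 / 12 * k) ≤ k * 1.026 := by
      gcongr
      linarith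
    rw [e1]
    nlinarith

theorem add_le_log_signal {n k p : ℕ} (hk : 1 ≤ k) (hp : 3 ≤ p) (hn : 78 ≤ n) :
    log k + 3.07 ≤ log (4 * (k : ℝ) * log ((n : ℝ) * p)) := by
  have hk' : (1 : ℝ) ≤ k := by exact_mod_cast hk
  have e1 := Real.exp_one_lt_d9
  have hnp : (234 : ℝ) ≤ (n : ℝ) * p := by
    have : 78 * 3 ≤ n * p := Nat.mul_le_mul hn hp
    exact_mod_cast this
  have h1 : 5.4 ≤ log ((n : ℝ) * p) := by
    rw [Real.le_log_iff_exp_le (by linarith)]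
    refine le_trans ?_ hnp
    have h2 : rexp 0.2 ≤ 1.25 := by
      have := Real.add_one_le_exp (-0.2 : ℝ)
      rw [Real.exp_neg] at this
      calc rexp 0.2 = (rexp 0.2)⁻¹⁻¹ := (inv_inv _).symm
        _ ≤ (0.8 : ℝ)⁻¹ := by gcongr; linarith
        _ = 1.25 := by norm_num
    calc rexp 5.4 = rexp 1 ^ 5 * rexp 0.2 ^ 2 := by
          rw [← Real.exp_nat_mul, ← Real.exp_nat_mul, ← Real.exp_add]; norm_num
      _ ≤ 2.7182818286 ^ 5 * 1.25 ^ 2 := by gcongr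
      _ ≤ 234 := by norm_num
  have h3 : 3.07 ≤ log 21.6 := by
    rw [Real.le_log_iff_exp_le (by norm_num)]
    have h2 : rexp 0.07 ≤ 0.93⁻¹ := by
      have := Real.add_one_le_exp (-0.07 : ℝ)
      rw [Real.exp_neg] at this
      calc rexp 0.07 = (rexp 0.07)⁻¹⁻¹ := (inv_inv _).symm
        _ ≤ (0.93 : ℝ)⁻¹ := by gcongr; linarith
    calc rexp 3.07 = rexp 1 ^ 3 * rexp 0.07 := by
          rw [← Real.exp_nat_mul, ← Real.exp_add]; norm_num
      _ ≤ 2.7182818286 ^ 3 * 0.93⁻¹ := by gcongr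
      _ ≤ 21.6 := by norm_num
  calc log k + 3.07 ≤ log k + log 21.6 := by gcongr
    _ = log (k * 21.6) := (Real.log_mul (by positivity) (by norm_num)).symm
    _ ≤ _ := Real.log_le_log (by positivity) (by nlinarith)

theorem le_exponent_slack {n k : ℕ} (hk : 1 ≤ k) (hn : 78 ≤ n) (hkn : 4 * (k : ℝ) * log k ≤ n) :
    8 * (k : ℝ) ≤ n ∧
    6.279 ≤ n / k * (0.115 * log k + 0.1064) + (4.3 * log k + 17.189) / k + 0.2 * log k := by
  have hk' : (1 : ℝ) ≤ k := by exact_mod_cast hk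
  have hn' : (78 : ℝ) ≤ n := by exact_mod_cast hn
  have l2 := Real.log_two_gt_d9
  have hK : 0 ≤ log k := Real.log_nonneg hk'
  rcases lt_or_ge k 9 with h | h
  · have h8 : (k : ℝ) ≤ 8 := by exact_mod_cast (by omega : k ≤ 8)
    refine ⟨by linarith, ?_⟩
    have h1 : 78 / (k : ℝ) * (0.115 * log k + 0.1064) ≤ n / k * (0.115 * log k + 0.1064) := by
      gcongr
    have key : 6.279 ≤ 78 / (k : ℝ) * (0.115 * log k + 0.1064) + (4.3 * log k + 17.189) / k
        + 0.2 * log k := by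
      have hlog : ∀ m : ℕ, 2 ^ m ≤ k → m * 0.69 ≤ log k := by
        intro m hm
        have : log ((2 : ℝ) ^ m) ≤ log k :=
          Real.log_le_log (by positivity) (by exact_mod_cast hm)
        rw [Real.log_pow] at this
        nlinarith [(Nat.cast_nonneg m : (0 : ℝ) ≤ m)]
      have h4 := hlog 2
      have h8 := hlog 3
      interval_cases k
      · norm_num
      · norm_num at hK ⊢; linarith
      · norm_num at hK ⊢; linarith
      all_goals norm_num at h4 h8 ⊢; linarith
    linarith
  · have h9 : (9 : ℝ) ≤ k := by exact_mod_cast h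
    set K := log k with hKdef
    have hK9 : 2.19 ≤ K := by
      have h1 : log 9 ≤ K := Real.log_le_log (by norm_num) h9
      have h2 : log 9 = 2 * log 3 := by
        rw [← Real.log_rpow (by norm_num)]; norm_num
      linarith [Real.log_three_gt_d9]
    refine ⟨by nlinarith, ?_⟩
    have hν : 4 * K ≤ n / k := by
      rw [le_div_iff₀ (by positivity)]; linarith
    have hν' : 4 * K * (0.115 * K + 0.1064) ≤ n / k * (0.115 * K + 0.1064) := by gcongr
    have hr : 0.082 * (3.5 - K) ≤ (k : ℝ)⁻¹ := by
      have e1 : (k : ℝ)⁻¹ = rexp (-2.5) * rexp (2.5 - K) := by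
        rw [← Real.exp_add, show (-2.5 + (2.5 - K) : ℝ) = -K by ring, Real.exp_neg, hKdef,
          Real.exp_log (by positivity)]
      have e2 : 0.082 ≤ rexp (-2.5) := by
        rw [Real.exp_neg, le_inv_comm₀ (by norm_num) (by positivity)]
        refine (pow_le_pow_iff_left₀ (by positivity) (by norm_num) two_ne_zero).1 ?_
        calc rexp 2.5 ^ 2 = rexp 1 ^ 5 := by
              rw [← Real.exp_nat_mul, ← Real.exp_nat_mul]; norm_num
          _ ≤ 2.7182818286 ^ 5 := by gcongr; exact Real.exp_one_lt_d9.le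
          _ ≤ _ := by norm_num
      have e3 := Real.add_one_le_exp (2.5 - K)
      rw [e1]
      calc 0.082 * (3.5 - K) ≤ 0.082 * rexp (2.5 - K) := by linarith
        _ ≤ _ := by gcongr
    have hr' : 0.082 * (3.5 - K) * (4.3 * K + 17.189) ≤ (k : ℝ)⁻¹ * (4.3 * K + 17.189) := by gcongr
    rw [div_eq_inv_mul (4.3 * K + 17.189)]
    nlinarith

theorem small_levelWeight_exponent_le {n k p : ℕ} (hk : 1 ≤ k) (hkp : k ≤ p) (hp : 3 ≤ p)
    (hn : 78 ≤ n) (hkn : 4 * (k : ℝ) * log p ≤ n) {ℓ : ℝ}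
    (hℓ : ℓ = log (4 * (k : ℝ) * log ((n : ℝ) * p))) :
    k * log p - k * log k + k + (k * (2.283 + 0.8 * ℓ + log (n / k) / 2) + 0.057 * n
      - (0.2 * ℓ + 0.25) * (0.575 * n + 21.5)) ≤ -(n : ℝ) / 48 - log 4 := by
  have hk' : (0 : ℝ) < k := by exact_mod_cast hk
  have hKP : log k ≤ log p := Real.log_le_log hk' (by exact_mod_cast hkp)
  have hn' : (78 : ℝ) ≤ n := by exact_mod_cast hn
  obtain ⟨h8, hslack⟩ := le_exponent_slack hk hn (le_trans (by gcongr) hkn)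
  have hℓ' : log k + 3.07 ≤ ℓ := hℓ ▸ add_le_log_signal hk hp hn
  have hK : 0 ≤ log k := Real.log_nonneg (by exact_mod_cast hk)
  set K := log k
  set P := log p
  have hP : P ≤ n / k / 4 := by
    rw [div_div, le_div_iff₀ (by positivity)]; linarith
  have hν8 : 8 ≤ (n : ℝ) / k := by rwa [le_div_iff₀ hk']
  have hlog : log (n / k) ≤ n / k / 8 - 1 + 2.0795 := by
    have h1 := Real.log_le_sub_one_of_pos (show 0 < (n : ℝ) / k / 8 by positivity)
    have h2 : log 8 = 3 * log 2 := by
      rw [← Real.log_rpow (by norm_num)]; norm_num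
    rw [Real.log_div (by positivity) (by norm_num), h2] at h1
    linarith [Real.log_two_lt_d9]
  have hlog4 : log 4 ≤ 1.3863 := by
    have h2 : log 4 = 2 * log 2 := by
      rw [← Real.log_rpow (by norm_num)]; norm_num
    linarith [Real.log_two_lt_d9]
  set ν := (n : ℝ) / k with hνdef
  have hnν : (n : ℝ) = ν * k := by rw [hνdef]; field_simp
  set r := (k : ℝ)⁻¹ with hrdef
  have hr : 0 ≤ r := by positivity
  have hrk : r * k = 1 := inv_mul_cancel₀ hk'.ne'
  rw [div_eq_mul_inv (4.3 * K + 17.189), ← hrdef] at hslack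
  have hmul : (K + 3.07) * (0.115 * ν + 4.3 * r - 0.8) ≤ ℓ * (0.115 * ν + 4.3 * r - 0.8) := by
    gcongr
    linarith
  have main : P - K + 1 + (2.283 + 0.8 * ℓ + log ν / 2 + 0.057 * ν
      - (0.2 * ℓ + 0.25) * (0.575 * ν + 21.5 * r)) + ν / 48 + 1.3863 * r ≤ 0 := by
    nlinarith
  have := mul_le_mul_of_nonneg_right main hk'.le
  rw [hnν]
  linear_combination this + hlog4 + (1.3863 - (0.2 * ℓ + 0.25) * 21.5) * (-hrk)

theorem gaussMat_exists_entry_gt_le {n p : ℕ} (hn : 1 ≤ n) (hp : 1 ≤ p) :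
    gaussMat n p (⋃ i, ⋃ j, {x | 4 * log ((n : ℝ) * p) < x i j ^ 2})
      ≤ ENNReal.ofReal (2 / ((n : ℝ) * p)) := by
  have hn' : (1 : ℝ) ≤ n := by exact_mod_cast hn
  have hp' : (1 : ℝ) ≤ p := by exact_mod_cast hp
  have hlog : 0 ≤ log ((n : ℝ) * p) := Real.log_nonneg (one_le_mul_of_one_le_of_one_le hn' hp')
  have hsum : gaussMat n p (⋃ i, ⋃ j, {x | 4 * log ((n : ℝ) * p) < x i j ^ 2})
      ≤ ∑ _i : Fin n, ∑ _j : Fin p,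
        ENNReal.ofReal (2 * rexp (-(4 * log ((n : ℝ) * p) / 2))) := by
    refine (measure_iUnion_fintype_le _ _).trans (Finset.sum_le_sum fun i _ => ?_)
    refine (measure_iUnion_fintype_le _ _).trans (Finset.sum_le_sum fun j _ => ?_)
    exact gaussMat_entry_sq_gt_le (by positivity) i j
  refine hsum.trans (le_of_eq ?_)
  simp only [Finset.sum_const, Finset.card_univ, Fintype.card_fin, ← ENNReal.ofReal_nsmul]
  congr 1
  have h1 : rexp (-(4 * log ((n : ℝ) * p) / 2)) = (((n : ℝ) * p) ^ 2)⁻¹ := by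
    rw [Real.exp_neg, show 4 * log ((n : ℝ) * p) / 2 = (2 : ℕ) * log ((n : ℝ) * p) by push_cast; ring,
      Real.exp_nat_mul, Real.exp_log (by positivity)]
  rw [h1]
  simp only [nsmul_eq_mul]
  field_simp

theorem gaussMat_exists_column_gt_le {n p : ℕ} (hn : 78 ≤ n) (hp : 1 ≤ p)
    (hpn : 4 * log p ≤ n) :
    gaussMat n p (⋃ j, {x | 3 * (n : ℝ) < ∑ i, x i j ^ 2})
      ≤ ENNReal.ofReal (rexp (-(n : ℝ) / 48) / 4) := by
  have hn' : (78 : ℝ) ≤ n := by exact_mod_cast hn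
  have hp' : (0 : ℝ) < p := by exact_mod_cast hp
  have hsum : gaussMat n p (⋃ j, {x | 3 * (n : ℝ) < ∑ i, x i j ^ 2})
      ≤ ∑ _j : Fin p, ENNReal.ofReal ((√3 * rexp (-1)) ^ n) :=
    (measure_iUnion_fintype_le _ _).trans
      (Finset.sum_le_sum fun j _ => gaussMat_column_gt_le j)
  refine hsum.trans ?_
  simp only [Finset.sum_const, Finset.card_univ, Fintype.card_fin, ← ENNReal.ofReal_nsmul]
  rw [nsmul_eq_mul]
  refine ENNReal.ofReal_le_ofReal ?_
  have h3 : √3 ≤ rexp 0.55 := by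
    rw [← Real.exp_log (show (0 : ℝ) < 3 by norm_num), ← Real.exp_half]
    gcongr
    linarith [Real.log_three_lt_d9]
  have hlog4 : log 4 ≤ 1.3863 := by
    have h2 : log 4 = 2 * log 2 := by
      rw [← Real.log_rpow (by norm_num)]; norm_num
    linarith [Real.log_two_lt_d9]
  calc (p : ℝ) * (√3 * rexp (-1)) ^ n ≤ rexp (log p) * (rexp 0.55 * rexp (-1)) ^ n := by
        rw [Real.exp_log hp']; gcongr
    _ = rexp (log p + n * (0.55 + -1)) := by
        rw [← Real.exp_add, ← Real.exp_nat_mul, ← Real.exp_add]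
    _ ≤ rexp (-(n : ℝ) / 48 - log 4) := by gcongr; linarith
    _ = _ := by rw [Real.exp_sub, Real.exp_log (by norm_num)]

theorem choose_le_exp {k p : ℕ} (hk : 1 ≤ k) (hp : 1 ≤ p) :
    (p.choose k : ℝ) ≤ rexp (k * log p - k * log k + k) := by
  have hk' : (0 : ℝ) < k := by exact_mod_cast hk
  have hp' : (0 : ℝ) < p := by exact_mod_cast hp
  rw [Real.exp_add, Real.exp_sub, Real.exp_nat_mul, Real.exp_nat_mul, Real.exp_log hp',
    Real.exp_log hk']
  have h2 := Real.pow_div_factorial_le_exp (x := k) hk'.le k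
  calc (p.choose k : ℝ) ≤ (p : ℝ) ^ k / (k.factorial : ℝ) := Nat.choose_le_pow_div k p
    _ = (p : ℝ) ^ k / (k : ℝ) ^ k * ((k : ℝ) ^ k / (k.factorial : ℝ)) := by field_simp
    _ ≤ _ := by gcongr

/-- Matrices for which the thresholded quadratic form restricted to `S` is small in some
direction although no column is large and many projections exceed the thresholds. -/
def degenerateSet (n : ℕ) {p : ℕ} (ℓ : ℝ) (u : Fin p → ℝ) (S : Finset (Fin p)) :
    Set (Fin n → Fin p → ℝ) :=
  {x | 0.575 * n + 21.5 ≤ ∑ i, thresholdCount (x i ⬝ᵥ u) ∧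
      (∀ j, ∑ i, x i j ^ 2 ≤ 3 * n) ∧ ∃ v : S → ℝ, v ⬝ᵥ v = 1 ∧
        ∑ i, levelWeight ℓ (x i ⬝ᵥ u) * (x i ⬝ᵥ extendVec S v) ^ 2 ≤ n / 72}

theorem gaussMat_degenerateSet_le {n k p : ℕ} (hk : 1 ≤ k) (hkp : k ≤ p) (hp : 3 ≤ p)
    (hn : 78 ≤ n) (hkn : 4 * (k : ℝ) * log p ≤ n) {u : Fin p → ℝ} (hu : u ⬝ᵥ u = 1) :
    gaussMat n p (⋃ S ∈ Finset.powersetCard k Finset.univ,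
      degenerateSet n (log (4 * (k : ℝ) * log ((n : ℝ) * p))) u S)
      ≤ ENNReal.ofReal (rexp (-(n : ℝ) / 48) / 4) := by
  have hk' : (0 : ℝ) < k := by exact_mod_cast hk
  have hKP : log k ≤ log p := Real.log_le_log hk' (by exact_mod_cast hkp)
  set ℓ := log (4 * (k : ℝ) * log ((n : ℝ) * p)) with hℓ
  have hℓ3 : 3 ≤ ℓ := by
    have h1 := add_le_log_signal hk hp hn
    have h2 : 0 ≤ log k := Real.log_nonneg (by exact_mod_cast hk)
    linarith
  have h8 : 8 * k ≤ n := by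
    exact_mod_cast (le_exponent_slack hk hn (le_trans (by gcongr) hkn)).1
  set E := k * (2.283 + 0.8 * ℓ + log (n / k) / 2) + 0.057 * n
      - (0.2 * ℓ + 0.25) * (0.575 * n + 21.5) with hE
  calc _ ≤ ∑ S ∈ Finset.powersetCard k (Finset.univ : Finset (Fin p)),
        gaussMat n p (degenerateSet n ℓ u S) := measure_biUnion_finset_le _ _
    _ ≤ ∑ S ∈ Finset.powersetCard k (Finset.univ : Finset (Fin p)), ENNReal.ofReal (rexp E) := by
        refine Finset.sum_le_sum fun S hS => ?_
        obtain ⟨-, rfl⟩ := Finset.mem_powersetCard.1 hS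
        exact gaussMat_small_levelWeight_le S u hu hℓ3 hk h8
    _ = ENNReal.ofReal (p.choose k * rexp E) := by
        rw [Finset.sum_const, Finset.card_powersetCard, Finset.card_univ, Fintype.card_fin,
          ← ENNReal.ofReal_nsmul, nsmul_eq_mul]
    _ ≤ _ := by
        refine ENNReal.ofReal_le_ofReal ?_
        calc p.choose k * rexp E ≤ rexp (k * log p - k * log k + k) * rexp E := by
              gcongr; exact choose_le_exp hk (by omega)
          _ = rexp (k * log p - k * log k + k + E) := (Real.exp_add _ _).symm
          _ ≤ rexp (-(n : ℝ) / 48 - log 4) := by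
              gcongr; exact small_levelWeight_exponent_le hk hkp hp hn hkn hℓ
          _ = _ := by rw [Real.exp_sub, Real.exp_log (by norm_num)]

theorem one_le_five_mul_exp {n : ℕ} (hn : n < 78) : 1 ≤ 5 * rexp (-(n : ℝ) / 48) := by
  have hn' : (n : ℝ) ≤ 77 := by exact_mod_cast (by omega : n ≤ 77)
  have e1 := Real.exp_one_lt_d9
  have h1 : rexp (77 / 48) ≤ 5 := by
    refine (pow_le_pow_iff_left₀ (by positivity) (by norm_num) (by norm_num : 5 ≠ 0)).1 ?_
    calc rexp (77 / 48) ^ 5 = rexp (385 / 48) := by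
          rw [← Real.exp_nat_mul]; norm_num
      _ ≤ rexp ((8 : ℕ) * 1 + 1 / 48) := by gcongr; norm_num
      _ = rexp 1 ^ 8 * rexp (1 / 48) := by rw [Real.exp_add, Real.exp_nat_mul]
      _ ≤ 2.7182818286 ^ 8 * 1.03 := by
          gcongr
          have h := Real.add_one_le_exp (-(1 / 48) : ℝ)
          rw [Real.exp_neg, le_inv_comm₀ (by norm_num) (by positivity)] at h
          exact h.trans (by norm_num)
      _ ≤ 5 ^ 5 := by norm_num
  have h2 : rexp (-(77 / 48)) ≤ rexp (-(n : ℝ) / 48) := by gcongr; linarith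
  rw [Real.exp_neg] at h2
  have h3 : (5 : ℝ)⁻¹ ≤ (rexp (77 / 48))⁻¹ := by gcongr
  linarith

theorem sum_sq_pos {p : ℕ} {θ : Fin p → ℝ} (hθ : θ ≠ 0) : 0 < ∑ j, θ j ^ 2 := by
  obtain ⟨j, hj⟩ := Function.ne_iff.1 hθ
  exact Finset.sum_pos' (fun _ _ => sq_nonneg _) ⟨j, Finset.mem_univ _, sq_pos_of_ne_zero hj⟩

theorem design_regular_of_notMem {n k p : ℕ} (hk : 1 ≤ k) (hkp : k ≤ p) (hp : 3 ≤ p)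
    (hn : 78 ≤ n) {θ : Fin p → ℝ} (hθ : θ ≠ 0)
    (hsignal : 2 * √2 * log (4 * (k : ℝ) * log ((n : ℝ) * p)) ≤ √(∑ j, θ j ^ 2))
    {x : Fin n → Fin p → ℝ}
    (h1 : 0.575 * (n : ℝ) + 21.5
      ≤ ∑ i, thresholdCount (x i ⬝ᵥ ((√(∑ j, θ j ^ 2))⁻¹ • θ)))
    (h2 : ∀ i j, x i j ^ 2 ≤ 4 * log ((n : ℝ) * p)) (h3 : ∀ j, ∑ i, x i j ^ 2 ≤ 3 * (n : ℝ))
    (h4 : ∀ S : Finset (Fin p), S.card = k → x ∉ degenerateSet n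
      (log (4 * (k : ℝ) * log ((n : ℝ) * p))) ((√(∑ j, θ j ^ 2))⁻¹ • θ) S)
    {S : Finset (Fin p)} (hSk : S.card ≤ k) :
    (gramW S (fun i => rexp (∑ j, x i j * θ j)) x).PosDef ∧
      ∀ i, √((fun l : S => x i l.1) ⬝ᵥ
        (gramW S (fun i' => rexp (∑ j, x i' j * θ j)) x)⁻¹.mulVec fun l : S => x i l.1)
        ≤ 6 * √2 / √n := by
  set t := √(∑ j, θ j ^ 2) with ht
  set u := t⁻¹ • θ
  set L := 4 * (k : ℝ) * log ((n : ℝ) * p) with hL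
  have hk' : (1 : ℝ) ≤ k := by exact_mod_cast hk
  have hn' : (78 : ℝ) ≤ n := by exact_mod_cast hn
  have hp' : (3 : ℝ) ≤ p := by exact_mod_cast hp
  have ht0 : 0 < t := Real.sqrt_pos.2 (sum_sq_pos hθ)
  have hlog0 : 0 < log ((n : ℝ) * p) := Real.log_pos (by nlinarith)
  have hL0 : 0 < L := by positivity
  have hℓ0 : 0 ≤ log L := by
    have := add_le_log_signal hk hp hn
    have h2 : 0 ≤ log k := Real.log_nonneg hk'
    linarith
  have hprod : ∀ i, x i ⬝ᵥ u * t = ∑ j, x i j * θ j := by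
    intro i
    rw [dotProduct_smul, smul_eq_mul, mul_comm, ← mul_assoc, mul_inv_cancel₀ ht0.ne', one_mul]
    rfl
  have hw : ∀ i, L * levelWeight (log L) (x i ⬝ᵥ u) ≤ rexp (∑ j, x i j * θ j) := by
    intro i
    have := exp_mul_levelWeight_le hℓ0 hsignal (x i ⬝ᵥ u)
    rwa [Real.exp_log hL0, hprod] at this
  obtain ⟨S', hSS', hS'⟩ := Finset.exists_superset_card_eq hSk (by simpa using hkp)
  have hv : ∀ v : S' → ℝ, v ⬝ᵥ v = 1 → (n : ℝ) / 72
      ≤ ∑ i, levelWeight (log L) (x i ⬝ᵥ u) * (x i ⬝ᵥ extendVec S' v) ^ 2 := by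
    intro v hv
    by_contra! hlt
    exact h4 S' hS' ⟨h1, h3, v, hv, hlt.le⟩
  have hquad := quadratic_lower_of_superset hSS' hL0.le hw hv
  have hm : 0 < L * ((n : ℝ) / 72) := by positivity
  refine ⟨gramW_posDef hm hquad, fun i => ?_⟩
  have hy : (fun l : S => x i l.1) ⬝ᵥ (fun l : S => x i l.1) ≤ L := by
    calc (fun l : S => x i l.1) ⬝ᵥ (fun l : S => x i l.1) = ∑ l : S, x i l.1 ^ 2 := by
          simp only [dotProduct, sq]
      _ ≤ ∑ _l : S, 4 * log ((n : ℝ) * p) := Finset.sum_le_sum fun l _ => h2 i l.1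
      _ = S.card * (4 * log ((n : ℝ) * p)) := by simp
      _ ≤ k * (4 * log ((n : ℝ) * p)) := by gcongr
      _ = L := by rw [hL]; ring
  have hrhs : 6 * √2 / √n = √(L / (L * ((n : ℝ) / 72))) := by
    rw [show L / (L * ((n : ℝ) / 72)) = 6 ^ 2 * 2 / n by field_simp; norm_num,
      Real.sqrt_div (by norm_num), Real.sqrt_mul (by norm_num), Real.sqrt_sq (by norm_num)]
  rw [hrhs]
  exact Real.sqrt_le_sqrt (dotProduct_gramW_inv_le hm hquad _ hy)

/-- design regularity for Poisson regression.  Note that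
`‖V^{-1/2}X_{i,S}‖₂ = √(X_{i,S}ᵀ V⁻¹ X_{i,S})`. -/
theorem stmt_13 (n p sstar : ℕ) (hn : 1 ≤ n) (hs : 1 ≤ sstar) (hsp : sstar ≤ p) (hp : 3 ≤ p)
    (θ₀ : Fin p → ℝ) (hθ₀ : θ₀ ≠ 0)
    (hsample : 4 * (sstar : ℝ) * Real.log p ≤ (n : ℝ))
    (hsignal : 2 * Real.sqrt 2 * Real.log (4 * (sstar : ℝ) * Real.log ((n : ℝ) * p))
      ≤ Real.sqrt (∑ j, θ₀ j ^ 2)) :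
    1 - ENNReal.ofReal (5 * Real.exp (-(n : ℝ) / 48) + 2 / ((n : ℝ) * p)) ≤
      gaussMat n p {x | ∀ S : Finset (Fin p), S.Nonempty → S.card ≤ sstar →
        (Finset.univ.filter fun j => θ₀ j ≠ 0) ⊆ S →
        (gramW S (fun i => Real.exp (∑ j, x i j * θ₀ j)) x).PosDef ∧
        ∀ i : Fin n,
          Real.sqrt ((fun l : S => x i l.1) ⬝ᵥ
              (gramW S (fun i' => Real.exp (∑ j, x i' j * θ₀ j)) x)⁻¹.mulVec
                fun l : S => x i l.1)
            ≤ 6 * Real.sqrt 2 / Real.sqrt n} := by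
  rcases lt_or_ge n 78 with hn78 | hn78
  · refine le_of_eq_of_le (tsub_eq_zero_of_le ?_) zero_le
    rw [ENNReal.one_le_ofReal]
    have : 0 ≤ 2 / ((n : ℝ) * p) := by positivity
    linarith [one_le_five_mul_exp hn78]
  set G := {x : Fin n → Fin p → ℝ | ∀ S : Finset (Fin p), S.Nonempty → S.card ≤ sstar →
        (Finset.univ.filter fun j => θ₀ j ≠ 0) ⊆ S →
        (gramW S (fun i => Real.exp (∑ j, x i j * θ₀ j)) x).PosDef ∧
        ∀ i : Fin n,
          Real.sqrt ((fun l : S => x i l.1) ⬝ᵥ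
              (gramW S (fun i' => Real.exp (∑ j, x i' j * θ₀ j)) x)⁻¹.mulVec
                fun l : S => x i l.1)
            ≤ 6 * Real.sqrt 2 / Real.sqrt n}
  have ht0 := sum_sq_pos hθ₀
  set u := (√(∑ j, θ₀ j ^ 2))⁻¹ • θ₀ with hu_def
  have hu : u ⬝ᵥ u = 1 := by
    have h : θ₀ ⬝ᵥ θ₀ = ∑ j, θ₀ j ^ 2 := by simp only [dotProduct, sq]
    rw [hu_def, dotProduct_smul, smul_dotProduct, h, smul_smul, smul_eq_mul, ← mul_inv,
      Real.mul_self_sqrt ht0.le, inv_mul_cancel₀ ht0.ne']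
  set B₁ := {x : Fin n → Fin p → ℝ | ∑ i, thresholdCount (x i ⬝ᵥ u) < 0.575 * n + 21.5}
  set B₂ := ⋃ i, ⋃ j, {x : Fin n → Fin p → ℝ | 4 * log ((n : ℝ) * p) < x i j ^ 2}
  set B₃ := ⋃ j, {x : Fin n → Fin p → ℝ | 3 * (n : ℝ) < ∑ i, x i j ^ 2}
  set B₄ := ⋃ S ∈ Finset.powersetCard sstar Finset.univ,
      degenerateSet n (log (4 * (sstar : ℝ) * log ((n : ℝ) * p))) u S
  have hcover : Set.univ ⊆ G ∪ (B₁ ∪ B₂ ∪ (B₃ ∪ B₄)) := by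
    intro x _
    by_contra hx
    simp only [Set.mem_union, not_or] at hx
    obtain ⟨hG, ⟨h1, h2⟩, h3, h4⟩ := hx
    refine hG fun S _ hSk _ => design_regular_of_notMem hs hsp hp hn78 hθ₀ hsignal (not_lt.1 h1)
      (fun i j => ?_) (fun j => ?_) (fun S' hS' hx => ?_) hSk
    · by_contra! h
      exact h2 (Set.mem_iUnion₂.2 ⟨i, j, h⟩)
    · by_contra! h
      exact h3 (Set.mem_iUnion.2 ⟨j, h⟩)
    · exact h4 (Set.mem_iUnion₂.2 ⟨S', by simp [hS'], hx⟩)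
  have hn0 : 4 * log p ≤ (n : ℝ) := by
    refine le_trans ?_ hsample
    have : (1 : ℝ) ≤ sstar := by exact_mod_cast hs
    have h0 : 0 ≤ log (p : ℝ) := Real.log_natCast_nonneg p
    nlinarith
  rw [tsub_le_iff_right]
  calc (1 : ENNReal) = gaussMat n p Set.univ := measure_univ.symm
    _ ≤ gaussMat n p G + (gaussMat n p B₁ + gaussMat n p B₂
        + (gaussMat n p B₃ + gaussMat n p B₄)) := by
      refine (measure_mono hcover).trans ((measure_union_le _ _).trans ?_)
      gcongr
      refine (measure_union_le _ _).trans ?_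
      gcongr <;> exact measure_union_le _ _
    _ ≤ gaussMat n p G + (ENNReal.ofReal (4.5 * rexp (-(n : ℝ) / 48))
        + ENNReal.ofReal (2 / ((n : ℝ) * p)) + (ENNReal.ofReal (rexp (-(n : ℝ) / 48) / 4)
        + ENNReal.ofReal (rexp (-(n : ℝ) / 48) / 4))) := by
      gcongr
      · exact gaussMat_thresholdCount_lt_le u hu
      · exact gaussMat_exists_entry_gt_le hn (by omega)
      · exact gaussMat_exists_column_gt_le hn78 (by omega) hn0
      · exact gaussMat_degenerateSet_le hs hsp hp hn78 hsample hu
    _ = _ := by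
      rw [← ENNReal.ofReal_add (by positivity) (by positivity),
        ← ENNReal.ofReal_add (by positivity) (by positivity),
        ← ENNReal.ofReal_add (by positivity) (by positivity)]
      congr 2
      ring
end

section
/- There exists a universal constant C > 0 such that if n ≥ C·s⋆·log(max(n,p)) and p ≥ C, then P(λ_min(∑_{i=1}^n exp(X_{i,S}ᵀθ_S)·X_{i,S}X_{i,S}ᵀ) ≤ n/540 for some S ∈ 𝒮_{s⋆} and some θ_S ∈ ℝ^{|S|}) ≤ 2/(n·p) + 3·exp(−n/50) + 3·exp(−n/30) + 3·exp(−n/240). -/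
open MeasureTheory ProbabilityTheory Matrix Real

/-- Smallest eigenvalue (Rayleigh quotient infimum over unit vectors). -/
noncomputable def lamMin {m : Type*} [Fintype m] (A : Matrix m m ℝ) : ℝ :=
  sInf {r : ℝ | ∃ u : m → ℝ, (∑ i, u i ^ 2) = 1 ∧ r = u ⬝ᵥ A.mulVec u}

theorem gaussianReal_abs_lt_le (t : ℝ) :
    gaussianReal 0 1 {x | |x| < t} ≤ ENNReal.ofReal t := by
  have hset : {x : ℝ | |x| < t} = Set.Ioo (-t) t := by
    ext x; simp [abs_lt]
  have hpdf : ∀ x : ℝ, gaussianPDF 0 1 x ≤ ENNReal.ofReal (1 / 2) := by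
    intro x
    refine ENNReal.ofReal_le_ofReal ?_
    rw [gaussianPDFReal]
    have h1 : Real.exp (-(x - 0) ^ 2 / (2 * ((1 : NNReal) : ℝ))) ≤ 1 := by
      refine Real.exp_le_one_iff.mpr ?_
      exact div_nonpos_of_nonpos_of_nonneg (neg_nonpos.mpr (sq_nonneg _)) (by positivity)
    have h2 : (2 : ℝ) ≤ √(2 * π * ((1 : NNReal) : ℝ)) := by
      refine Real.le_sqrt_of_sq_le ?_
      have := Real.pi_gt_three
      norm_num
      linarith
    have h3 : (√(2 * π * ((1 : NNReal) : ℝ)))⁻¹ ≤ 1 / 2 := by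
      rw [one_div]
      exact inv_anti₀ (by norm_num) h2
    calc _ ≤ (1 / 2 : ℝ) * 1 := by gcongr
      _ = 1 / 2 := by norm_num
  rw [gaussianReal_apply 0 one_ne_zero, hset]
  calc ∫⁻ x in Set.Ioo (-t) t, gaussianPDF 0 1 x
      ≤ ∫⁻ _ in Set.Ioo (-t) t, ENNReal.ofReal (1 / 2) := lintegral_mono fun x => hpdf x
    _ = ENNReal.ofReal t := by
      rw [setLIntegral_const, Real.volume_Ioo, ← ENNReal.ofReal_mul (by norm_num)]
      congr 1; ring

theorem map_linearForm_pi_gaussianReal {ι : Type*} [Fintype ι] (v : ι → ℝ)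
    (hv : ∑ j, v j ^ 2 = 1) :
    (Measure.pi fun _ : ι => gaussianReal 0 1).map (fun x => ∑ j, x j * v j) =
      gaussianReal 0 1 := by
  have hm : Measurable fun x : ι → ℝ => ∑ j, x j * v j := by fun_prop
  have := Measure.isProbabilityMeasure_map (μ := Measure.pi fun _ : ι => gaussianReal 0 1)
    hm.aemeasurable
  refine Measure.ext_of_charFun ?_
  ext t
  rw [charFun_apply_real, integral_map hm.aemeasurable (by fun_prop), charFun_gaussianReal]
  have hpt : ∀ x : ι → ℝ, Complex.exp (t * ((∑ j, x j * v j : ℝ) : ℂ) * Complex.I) =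
      ∏ j, Complex.exp (((t * v j : ℝ) : ℂ) * x j * Complex.I) := by
    intro x
    rw [← Complex.exp_sum]
    congr 1
    push_cast
    rw [Finset.mul_sum, Finset.sum_mul]
    exact Finset.sum_congr rfl fun j _ => by ring
  simp_rw [hpt]
  rw [integral_fintype_prod_eq_prod
    (f := fun j (y : ℝ) => Complex.exp (((t * v j : ℝ) : ℂ) * y * Complex.I))]
  simp_rw [← charFun_apply_real, charFun_gaussianReal, ← Complex.exp_sum]
  congr 1
  have hv' : ∑ j, ((v j : ℂ)) ^ 2 = 1 := by exact_mod_cast hv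
  simp only [Complex.ofReal_zero, mul_zero, zero_mul, zero_sub, NNReal.coe_one,
    Complex.ofReal_one, one_mul, Complex.ofReal_mul, mul_pow]
  rw [Finset.sum_neg_distrib, ← Finset.sum_div, ← Finset.mul_sum, hv', mul_one]

theorem measurableSet_halfspace_slab {ι : Type*} [Fintype ι] (u v : ι → ℝ) :
    MeasurableSet {x : ι → ℝ | 1 / 4 ≤ ∑ j, x j * v j ∧ 1 / 4 ≤ |∑ j, x j * u j|} := by
  have h1 : MeasurableSet {x : ι → ℝ | 1 / 4 ≤ ∑ j, x j * v j} :=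
    measurableSet_le measurable_const (by fun_prop)
  have h2 : MeasurableSet {x : ι → ℝ | 1 / 4 ≤ |∑ j, x j * u j|} :=
    measurableSet_le measurable_const (by fun_prop)
  exact h1.inter h2

theorem pi_gaussianReal_halfspace_slab {ι : Type*} [Fintype ι] (u v : ι → ℝ)
    (hu : ∑ j, u j ^ 2 = 1) (hv : ∑ j, v j ^ 2 = 1) :
    (1 / 4 : ℝ) ≤ (Measure.pi fun _ : ι => gaussianReal 0 1).real
      {x | 1 / 4 ≤ ∑ j, x j * v j ∧ 1 / 4 ≤ |∑ j, x j * u j|} := by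
  set μ := Measure.pi fun _ : ι => gaussianReal 0 1 with hμ
  have hsmall : ∀ w : ι → ℝ, ∑ j, w j ^ 2 = 1 →
      μ.real {x | |∑ j, x j * w j| < 1 / 4} ≤ 1 / 4 := by
    intro w hw
    have hm : Measurable fun x : ι → ℝ => ∑ j, x j * w j := by fun_prop
    have h := gaussianReal_abs_lt_le (1 / 4)
    rw [← map_linearForm_pi_gaussianReal w hw, Measure.map_apply hm
      (measurableSet_lt (by fun_prop) measurable_const)] at h
    exact ENNReal.toReal_le_of_le_ofReal (by norm_num) h
  have hneg : MeasurePreserving (fun x : ι → ℝ => fun j => -x j) μ μ :=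
    measurePreserving_pi _ _ fun _ => ⟨measurable_neg, by simp [gaussianReal_map_neg]⟩
  set P := {x : ι → ℝ | 1 / 4 ≤ ∑ j, x j * v j ∧ 1 / 4 ≤ |∑ j, x j * u j|} with hP
  set N := {x : ι → ℝ | 1 / 4 ≤ -∑ j, x j * v j ∧ 1 / 4 ≤ |∑ j, x j * u j|} with hN
  have hPm : MeasurableSet P := measurableSet_halfspace_slab u v
  have hPN : μ.real N = μ.real P := by
    have h := hneg.measureReal_preimage hPm.nullMeasurableSet
    rw [← h]
    congr 1
    ext x
    simp [hP, hN]
  have hcover : (Set.univ : Set (ι → ℝ)) ⊆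
      (P ∪ N) ∪ ({x | |∑ j, x j * u j| < 1 / 4} ∪ {x | |∑ j, x j * v j| < 1 / 4}) := by
    intro x _
    by_cases h1 : |∑ j, x j * u j| < 1 / 4
    · exact Or.inr (Or.inl h1)
    by_cases h2 : |∑ j, x j * v j| < 1 / 4
    · exact Or.inr (Or.inr h2)
    push Not at h1 h2
    rcases le_abs.mp h2 with h | h
    · exact Or.inl (Or.inl ⟨h, h1⟩)
    · exact Or.inl (Or.inr ⟨h, h1⟩)
  have h1 : μ.real Set.univ = 1 := by simp
  have h2 := measureReal_mono (μ := μ) hcover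
  have h3 := measureReal_union_le (μ := μ) (P ∪ N)
    ({x | |∑ j, x j * u j| < 1 / 4} ∪ {x | |∑ j, x j * v j| < 1 / 4})
  have h4 := measureReal_union_le (μ := μ) P N
  have h5 := measureReal_union_le (μ := μ) {x : ι → ℝ | |∑ j, x j * u j| < 1 / 4}
    {x | |∑ j, x j * v j| < 1 / 4}
  have h6 := hsmall u hu
  have h7 := hsmall v hv
  linarith

theorem pi_few_hits_le {E : Type*} [MeasurableSpace E] (μ : Measure E) [IsProbabilityMeasure μ]
    {G : Set E} (hG : MeasurableSet G) (hq : (1 / 4 : ℝ) ≤ μ.real G) (n : ℕ) :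
    (Measure.pi fun _ : Fin n => μ).real
      {x | ∑ i, G.indicator (fun _ => (1 : ℝ)) (x i) ≤ n / 16} ≤ Real.exp (-(n : ℝ) / 16) := by
  set ν := Measure.pi fun _ : Fin n => μ with hν
  have hGm : Measurable (G.indicator fun _ => (1 : ℝ)) := measurable_const.indicator hG
  have hg01 : ∀ y, 0 ≤ G.indicator (fun _ => (1 : ℝ)) y :=
    fun y => Set.indicator_nonneg (fun _ _ => zero_le_one) y
  have hexp : ∀ y, Real.exp (-G.indicator (fun _ => (1 : ℝ)) y) =
      1 - G.indicator (fun _ => 1 - Real.exp (-1)) y := by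
    intro y
    by_cases hy : y ∈ G <;> simp [hy]
  have he : Real.exp (-1) ≤ 1 / 2 := by
    have := Real.exp_neg_one_lt_d9
    linarith
  have hint : ∫ y, Real.exp (-G.indicator (fun _ => (1 : ℝ)) y) ∂μ ≤ Real.exp (-(1 / 8)) := by
    simp_rw [hexp]
    rw [integral_sub (integrable_const _) ((integrable_const _).indicator hG),
      integral_indicator_const _ hG]
    simp only [integral_const, probReal_univ, smul_eq_mul, one_mul]
    have := Real.add_one_le_exp (-(1 / 8 : ℝ))
    nlinarith
  have hprod : ∀ x : Fin n → E, Real.exp (-∑ i, G.indicator (fun _ => (1 : ℝ)) (x i)) =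
      ∏ i, Real.exp (-G.indicator (fun _ => (1 : ℝ)) (x i)) := by
    intro x
    rw [← Finset.sum_neg_distrib, Real.exp_sum]
  have hI : ∫ x, Real.exp (-∑ i, G.indicator (fun _ => (1 : ℝ)) (x i)) ∂ν ≤
      Real.exp (-(n : ℝ) / 8) := by
    simp_rw [hprod]
    rw [integral_fintype_prod_eq_pow (μ := μ)
      (fun y => Real.exp (-G.indicator (fun _ => (1 : ℝ)) y)), Fintype.card_fin]
    calc _ ≤ Real.exp (-(1 / 8)) ^ n :=
          pow_le_pow_left₀ (integral_nonneg fun y => (Real.exp_pos _).le) hint n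
      _ = _ := by rw [← Real.exp_nat_mul]; congr 1; ring
  have hm : Measurable fun x : Fin n → E =>
      Real.exp (-∑ i, G.indicator (fun _ => (1 : ℝ)) (x i)) := by
    refine Real.measurable_exp.comp (Measurable.neg ?_)
    exact Finset.measurable_sum _ fun i _ => hGm.comp (measurable_pi_apply i)
  have hintegrable : Integrable (fun x : Fin n → E =>
      Real.exp (-∑ i, G.indicator (fun _ => (1 : ℝ)) (x i))) ν := by
    refine Integrable.of_bound hm.aestronglyMeasurable 1 (ae_of_all _ fun x => ?_)
    rw [Real.norm_eq_abs, abs_of_pos (Real.exp_pos _), Real.exp_le_one_iff, neg_nonpos]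
    exact Finset.sum_nonneg fun i _ => hg01 _
  have hmarkov := mul_meas_ge_le_integral_of_nonneg
    (ae_of_all ν fun x => (Real.exp_pos (-∑ i, G.indicator (fun _ => (1 : ℝ)) (x i))).le)
    hintegrable (Real.exp (-(n : ℝ) / 16))
  have hset : {x : Fin n → E | ∑ i, G.indicator (fun _ => (1 : ℝ)) (x i) ≤ n / 16} =
      {x | Real.exp (-(n : ℝ) / 16) ≤
        Real.exp (-∑ i, G.indicator (fun _ => (1 : ℝ)) (x i))} := by
    ext x
    simp only [Set.mem_ofPred_eq, Real.exp_le_exp]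
    constructor <;> intro h <;> linarith
  rw [hset]
  have h2 : Real.exp (-(n : ℝ) / 8) = Real.exp (-(n : ℝ) / 16) * Real.exp (-(n : ℝ) / 16) := by
    rw [← Real.exp_add]; congr 1; ring
  have h3 := hmarkov.trans hI
  rw [h2] at h3
  exact le_of_mul_le_mul_left h3 (Real.exp_pos _)

theorem exists_finset_code_representatives {V κ : Type*} [Fintype κ] (T : Set V) (code : V → κ) :
    ∃ N : Finset V, N.card ≤ Fintype.card κ ∧ (∀ w ∈ N, w ∈ T) ∧
      ∀ v ∈ T, ∃ w ∈ N, code w = code v := by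
  classical
  obtain ⟨T', hT', hbij⟩ := Set.exists_subset_bijOn T code
  have hfin : T'.Finite := Set.Finite.of_injOn hbij.mapsTo hbij.injOn (Set.toFinite _)
  refine ⟨hfin.toFinset, ?_, fun w hw => hT' (hfin.mem_toFinset.mp hw), fun v hv => ?_⟩
  · refine Finset.card_le_card_of_injOn (t := Finset.univ) code (fun _ _ => Finset.mem_univ _) ?_
    simpa using hbij.injOn
  · obtain ⟨w, hw, hwv⟩ := hbij.surjOn (Set.mem_image_of_mem code hv)
    exact ⟨w, hfin.mem_toFinset.mpr hw, hwv⟩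

/-- Unit vectors supported on `S` have a small net in the supremum distance. -/
theorem exists_net_sparse_unit {p : ℕ} (S : Finset (Fin p)) {K : ℕ} (hK : 0 < K) :
    ∃ N : Finset (Fin p → ℝ), N.card ≤ (2 * K + 1) ^ S.card ∧
      (∀ w ∈ N, ∑ j, w j ^ 2 = 1) ∧
      ∀ v : Fin p → ℝ, ∑ j, v j ^ 2 = 1 → (∀ j ∉ S, v j = 0) →
        ∃ w ∈ N, ∀ j, |v j - w j| ≤ 1 / K := by
  have hK' : (0 : ℝ) < K := by exact_mod_cast hK
  let code : (Fin p → ℝ) → S → Fin (2 * K + 1) := fun v j =>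
    ⟨min ⌊(v j + 1) * K⌋₊ (2 * K), by omega⟩
  obtain ⟨N, hcard, hmem, hcode⟩ := exists_finset_code_representatives
    {v : Fin p → ℝ | ∑ j, v j ^ 2 = 1 ∧ ∀ j ∉ S, v j = 0} code
  refine ⟨N, by simpa using hcard, fun w hw => (hmem w hw).1, fun v hv hvS => ?_⟩
  obtain ⟨w, hw, hwv⟩ := hcode v ⟨hv, hvS⟩
  obtain ⟨hw1, hwS⟩ := hmem w hw
  refine ⟨w, hw, fun j => ?_⟩
  by_cases hj : j ∈ S
  · have hbound : ∀ z : Fin p → ℝ, ∑ j, z j ^ 2 = 1 →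
        0 ≤ (z j + 1) * K ∧ ⌊(z j + 1) * (K : ℝ)⌋₊ ≤ 2 * K := by
      intro z hz
      have h1 : z j ^ 2 ≤ 1 := by
        rw [← hz]
        exact Finset.single_le_sum (f := fun j => z j ^ 2) (fun _ _ => sq_nonneg _)
          (Finset.mem_univ j)
      obtain ⟨h2, h3⟩ := abs_le.mp ((sq_le_one_iff_abs_le_one _).mp h1)
      refine ⟨mul_nonneg (by linarith) hK'.le, Nat.floor_le_of_le ?_⟩
      push_cast
      nlinarith
    obtain ⟨hv0, hvK⟩ := hbound v hv
    obtain ⟨hw0, hwK⟩ := hbound w hw1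
    have hfloor : ⌊(w j + 1) * (K : ℝ)⌋₊ = ⌊(v j + 1) * (K : ℝ)⌋₊ := by
      have h := congrArg Fin.val (congrFun hwv ⟨j, hj⟩)
      simpa [code, min_eq_left hvK, min_eq_left hwK] using h
    have h1 := Nat.floor_le hv0
    have h2 := Nat.lt_floor_add_one ((v j + 1) * (K : ℝ))
    have h3 := Nat.floor_le hw0
    have h4 := Nat.lt_floor_add_one ((w j + 1) * (K : ℝ))
    rw [hfloor] at h3 h4
    rw [le_div_iff₀ hK', ← abs_of_pos hK', ← abs_mul, abs_le]
    constructor <;> nlinarith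
  · rw [hvS j hj, hwS j hj, sub_zero, abs_zero]
    positivity

theorem dotProduct_gramW_mulVec_s14 {n p : ℕ} (S : Finset (Fin p)) (w : Fin n → ℝ)
    (x : Fin n → Fin p → ℝ) (u : S → ℝ) :
    u ⬝ᵥ (gramW S w x).mulVec u = ∑ i, w i * (∑ j : S, x i j.1 * u j) ^ 2 := by
  simp only [dotProduct, mulVec, gramW, Matrix.of_apply, Finset.mul_sum, Finset.sum_mul, sq]
  rw [Finset.sum_congr rfl fun j _ => Finset.sum_comm, Finset.sum_comm]
  refine Finset.sum_congr rfl fun i _ => ?_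
  rw [Finset.sum_comm]
  exact Finset.sum_congr rfl fun j _ => Finset.sum_congr rfl fun k _ => by ring

theorem exists_extend_by_zero {p : ℕ} (S : Finset (Fin p)) (u : S → ℝ) :
    ∃ v : Fin p → ℝ, (∀ j ∉ S, v j = 0) ∧ (∑ j, v j ^ 2 = ∑ j, u j ^ 2) ∧
      ∀ y : Fin p → ℝ, ∑ j : S, y j.1 * u j = ∑ j, y j * v j := by
  classical
  let v : Fin p → ℝ := fun j => if h : j ∈ S then u ⟨j, h⟩ else 0
  have hvS : ∀ j ∉ S, v j = 0 := fun j hj => by simp [v, hj]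
  have hvu : ∀ j : S, v j = u j := fun j => by simp [v]
  refine ⟨v, hvS, ?_, fun y => ?_⟩
  · simp_rw [← hvu]
    rw [Finset.sum_coe_sort S fun j => v j ^ 2]
    exact (Finset.sum_subset (Finset.subset_univ S) fun j _ hj => by simp [hvS j hj]).symm
  · simp_rw [← hvu]
    rw [Finset.sum_coe_sort S fun j => y j * v j]
    exact Finset.sum_subset (Finset.subset_univ S) fun j _ hj => by simp [hvS j hj]

theorem exists_nonneg_smul_unit {p : ℕ} {S : Finset (Fin p)} {u : Fin p → ℝ}
    (hu : ∑ j, u j ^ 2 = 1) (huS : ∀ j ∉ S, u j = 0) (θ : Fin p → ℝ) (hθ : ∀ j ∉ S, θ j = 0) :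
    ∃ c : ℝ, 0 ≤ c ∧ ∃ v : Fin p → ℝ, ∑ j, v j ^ 2 = 1 ∧ (∀ j ∉ S, v j = 0) ∧
      ∀ j, θ j = c * v j := by
  have hnn : 0 ≤ ∑ j, θ j ^ 2 := Finset.sum_nonneg fun _ _ => sq_nonneg _
  rcases hnn.eq_or_lt with h0 | hpos
  · refine ⟨0, le_rfl, u, hu, huS, fun j => ?_⟩
    have := (Finset.sum_eq_zero_iff_of_nonneg fun _ _ => sq_nonneg _).mp h0.symm j
      (Finset.mem_univ j)
    simpa using this
  · have hs : 0 < √(∑ j, θ j ^ 2) := Real.sqrt_pos.mpr hpos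
    refine ⟨√(∑ j, θ j ^ 2), hs.le, fun j => θ j / √(∑ j, θ j ^ 2), ?_, fun j hj => ?_,
      fun j => ?_⟩
    · simp_rw [div_pow, Real.sq_sqrt hnn]
      rw [← Finset.sum_div, div_self hpos.ne']
    · simp [hθ j hj]
    · field_simp

theorem abs_sum_mul_sub_le {p : ℕ} {y v w : Fin p → ℝ} {M ε : ℝ} (hy : ∀ j, |y j| ≤ M)
    (hvw : ∀ j, |v j - w j| ≤ ε) (hM : 0 ≤ M) :
    |∑ j, y j * v j - ∑ j, y j * w j| ≤ p * (M * ε) := by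
  rw [← Finset.sum_sub_distrib]
  calc _ ≤ ∑ j, |y j * v j - y j * w j| := Finset.abs_sum_le_sum_abs _ _
    _ ≤ ∑ _j : Fin p, M * ε := Finset.sum_le_sum fun j _ => by
        rw [← mul_sub, abs_mul]
        exact mul_le_mul (hy j) (hvw j) (abs_nonneg _) hM
    _ = p * (M * ε) := by simp

theorem indicator_le_exp_mul_sq {p : ℕ} {y θ u v' u' v : Fin p → ℝ} {c M ε : ℝ}
    (hc : 0 ≤ c) (hθ : ∀ j, θ j = c * v j) (hy : ∀ j, |y j| ≤ M) (hM : 0 ≤ M)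
    (hv : ∀ j, |v j - v' j| ≤ ε) (hu : ∀ j, |u j - u' j| ≤ ε) (hε : p * (M * ε) ≤ 1 / 16) :
    9 / 256 * Set.indicator {x : Fin p → ℝ | 1 / 4 ≤ ∑ j, x j * v' j ∧
      1 / 4 ≤ |∑ j, x j * u' j|} (fun _ => (1 : ℝ)) y ≤
      Real.exp (∑ j, y j * θ j) * (∑ j, y j * u j) ^ 2 := by
  by_cases hmem : y ∈ {x : Fin p → ℝ | 1 / 4 ≤ ∑ j, x j * v' j ∧ 1 / 4 ≤ |∑ j, x j * u' j|}
  · rw [Set.indicator_of_mem hmem]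
    obtain ⟨h1, h2⟩ := hmem
    have h3 := abs_le.mp ((abs_sum_mul_sub_le hy hv hM).trans hε)
    have h4 := (abs_sum_mul_sub_le hy hu hM).trans hε
    have h5 : 0 ≤ ∑ j, y j * θ j := by
      have : ∑ j, y j * θ j = c * ∑ j, y j * v j := by
        rw [Finset.mul_sum]
        exact Finset.sum_congr rfl fun j _ => by rw [hθ]; ring
      rw [this]
      exact mul_nonneg hc (by linarith [h3.1])
    have h6 : 3 / 16 ≤ |∑ j, y j * u j| := by
      have := abs_sub_abs_le_abs_sub (∑ j, y j * u' j) (∑ j, y j * u j)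
      rw [abs_sub_comm] at this
      linarith
    have h7 : 9 / 256 ≤ (∑ j, y j * u j) ^ 2 := by
      rw [← sq_abs]
      nlinarith
    have h8 := Real.one_le_exp h5
    nlinarith
  · rw [Set.indicator_of_notMem hmem, mul_zero]
    positivity

theorem gaussMat_large_entry_le {n p : ℕ} {M : ℝ} (hM : 0 < M) :
    (gaussMat n p).real {x | ∃ i j, M ≤ |x i j|} ≤ n * p * (1 / M ^ 2) := by
  have hsub : {x : Fin n → Fin p → ℝ | ∃ i j, M ≤ |x i j|} ⊆
      ⋃ q : Fin n × Fin p, {x | M ≤ |x q.1 q.2|} := by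
    rintro x ⟨i, j, h⟩
    exact Set.mem_iUnion.mpr ⟨(i, j), h⟩
  have : IsProbabilityMeasure (gaussMat n p) := by unfold gaussMat; infer_instance
  have hentry : ∀ q : Fin n × Fin p, (gaussMat n p).real {x | M ≤ |x q.1 q.2|} ≤ 1 / M ^ 2 := by
    intro q
    have hmp : MeasurePreserving (fun x : Fin n → Fin p → ℝ => x q.1 q.2) (gaussMat n p)
        (gaussianReal 0 1) :=
      (measurePreserving_eval (fun _ : Fin p => gaussianReal 0 1) q.2).comp
        (measurePreserving_eval (fun _ : Fin n => Measure.pi fun _ : Fin p => gaussianReal 0 1) q.1)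
    have hms : MeasurableSet {y : ℝ | M ≤ |y|} := measurableSet_le measurable_const (by fun_prop)
    have h := hmp.measure_preimage hms.nullMeasurableSet
    have hc := meas_ge_le_variance_div_sq (μ := gaussianReal 0 1) (X := id)
      (memLp_id_gaussianReal 2) hM
    rw [variance_id_gaussianReal] at hc
    simp only [id_eq, integral_id_gaussianReal, sub_zero, NNReal.coe_one] at hc
    rw [← h] at hc
    exact ENNReal.toReal_le_of_le_ofReal (by positivity) hc
  calc _ ≤ (gaussMat n p).real (⋃ q : Fin n × Fin p, {x | M ≤ |x q.1 q.2|}) :=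
        measureReal_mono hsub
    _ ≤ ∑ q : Fin n × Fin p, (gaussMat n p).real {x | M ≤ |x q.1 q.2|} :=
        measureReal_iUnion_fintype_le _
    _ ≤ ∑ _q : Fin n × Fin p, 1 / M ^ 2 := Finset.sum_le_sum fun q _ => hentry q
    _ = _ := by simp

/-- The matrices with few rows in the intersection of a half-space and the complement of a slab. -/
def fewHits (n : ℕ) {p : ℕ} (u v : Fin p → ℝ) : Set (Fin n → Fin p → ℝ) :=
  {x | ∑ i, Set.indicator {y : Fin p → ℝ | 1 / 4 ≤ ∑ j, y j * v j ∧ 1 / 4 ≤ |∑ j, y j * u j|}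
    (fun _ => (1 : ℝ)) (x i) ≤ n / 16}

theorem lt_lamMin_gramW_exp {n p s : ℕ} (hn : 1 ≤ n) (hp : 1 ≤ p) (hsp : s ≤ p)
    (N : Finset (Fin p) → Finset (Fin p → ℝ))
    (hN : ∀ S, ∀ v : Fin p → ℝ, ∑ j, v j ^ 2 = 1 → (∀ j ∉ S, v j = 0) →
      ∃ w ∈ N S, ∀ j, |v j - w j| ≤ 1 / (16 * n * p ^ 2 : ℕ))
    {x : Fin n → Fin p → ℝ} (hx : ∀ i j, |x i j| ≤ (n : ℝ) * p)
    (hhits : ∀ S ∈ Finset.powersetCard s (Finset.univ : Finset (Fin p)),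
      ∀ q ∈ N S ×ˢ N S, x ∉ fewHits n q.1 q.2)
    {S : Finset (Fin p)} (hS : S.Nonempty) (hcard : S.card ≤ s) (θ : S → ℝ) :
    (n : ℝ) / 540 < lamMin (gramW S (fun i => Real.exp (∑ j : S, x i j.1 * θ j)) x) := by
  classical
  have hn0 : (0 : ℝ) < n := by exact_mod_cast hn
  have hp0 : (0 : ℝ) < p := by exact_mod_cast hp
  suffices h : (n : ℝ) / 500 ≤
      lamMin (gramW S (fun i => Real.exp (∑ j : S, x i j.1 * θ j)) x) by
    refine lt_of_lt_of_le ?_ h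
    linarith
  unfold lamMin
  refine le_csInf ?_ ?_
  · obtain ⟨j, hj⟩ := hS
    exact ⟨_, Pi.single ⟨j, hj⟩ 1, by simp [Pi.single_apply, ite_pow], rfl⟩
  rintro r ⟨u, hu, rfl⟩
  rw [dotProduct_gramW_mulVec_s14]
  obtain ⟨U, hUS, hU, hUsum⟩ := exists_extend_by_zero S u
  obtain ⟨Θ, hΘS, -, hΘsum⟩ := exists_extend_by_zero S θ
  obtain ⟨S', hSS', -, hS'⟩ := Finset.exists_subsuperset_card_eq (Finset.subset_univ S) hcard
    (by simpa using hsp)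
  rw [hu] at hU
  obtain ⟨c, hc, v, hv, hvS, hΘ⟩ := exists_nonneg_smul_unit hU hUS Θ hΘS
  obtain ⟨u', hu'N, hu'⟩ := hN S' U hU fun j hj => hUS j fun h => hj (hSS' h)
  obtain ⟨v', hv'N, hv'⟩ := hN S' v hv fun j hj => hvS j fun h => hj (hSS' h)
  have hfew := hhits S' (by simp [Finset.mem_powersetCard, hS']) (u', v')
    (Finset.mem_product.mpr ⟨hu'N, hv'N⟩)
  have hhit : (n : ℝ) / 16 < ∑ i, Set.indicator {y : Fin p → ℝ | 1 / 4 ≤ ∑ j, y j * v' j ∧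
      1 / 4 ≤ |∑ j, y j * u' j|} (fun _ => (1 : ℝ)) (x i) := not_le.mp hfew
  have hε : (p : ℝ) * (n * p * (1 / (16 * n * p ^ 2 : ℕ))) ≤ 1 / 16 := by
    push_cast
    apply le_of_eq
    field_simp
  calc (n : ℝ) / 500 ≤ 9 / 256 * (n / 16) := by linarith
    _ ≤ 9 / 256 * ∑ i, Set.indicator {y : Fin p → ℝ | 1 / 4 ≤ ∑ j, y j * v' j ∧
        1 / 4 ≤ |∑ j, y j * u' j|} (fun _ => (1 : ℝ)) (x i) := by gcongr
    _ ≤ _ := by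
      rw [Finset.mul_sum]
      refine Finset.sum_le_sum fun i _ => ?_
      rw [hΘsum, hUsum]
      exact indicator_le_exp_mul_sq hc hΘ (hx i) (by positivity) hv' hu' hε

theorem net_card_mul_exp_le {n p s : ℕ} (hn : 1 ≤ n) (hs : 1 ≤ s) (hp : 33 ≤ p)
    (hlog : 1000 * (s : ℝ) * Real.log (max n p : ℕ) ≤ n) :
    (p.choose s : ℝ) * (((2 * (16 * n * p ^ 2) + 1) ^ s : ℕ) *
      ((2 * (16 * n * p ^ 2) + 1) ^ s : ℕ) * Real.exp (-(n : ℝ) / 16)) ≤ 1 / (n * p) := by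
  set m := max n p with hm
  have hnm : n ≤ m := le_max_left _ _
  have hpm : p ≤ m := le_max_right _ _
  have hm33 : 33 ≤ m := hp.trans hpm
  have hL : 2 * (16 * n * p ^ 2) + 1 ≤ m ^ 4 := by
    have h1 : n * p ^ 2 ≤ m * m ^ 2 := Nat.mul_le_mul hnm (Nat.pow_le_pow_left hpm 2)
    have h2 : 33 * m ^ 3 ≤ m ^ 4 := by
      rw [pow_succ m 3, mul_comm]
      exact Nat.mul_le_mul_left _ hm33
    have h3 : 1 ≤ m ^ 3 := Nat.one_le_pow _ _ (by omega)
    have h4 : m * m ^ 2 = m ^ 3 := by ring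
    rw [h4] at h1
    calc 2 * (16 * n * p ^ 2) + 1 = 32 * (n * p ^ 2) + 1 := by ring
      _ ≤ m ^ 4 := by omega
  have hnp : n * p ≤ m ^ (2 * s) := by
    calc n * p ≤ m * m := Nat.mul_le_mul hnm hpm
      _ = m ^ 2 := by ring
      _ ≤ m ^ (2 * s) := Nat.pow_le_pow_right (by omega) (by omega)
  have hch : p.choose s ≤ m ^ s := (Nat.choose_le_pow p s).trans (Nat.pow_le_pow_left hpm s)
  have hLs := Nat.pow_le_pow_left hL s
  have hnat : p.choose s * ((2 * (16 * n * p ^ 2) + 1) ^ s * (2 * (16 * n * p ^ 2) + 1) ^ s) *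
      (n * p) ≤ m ^ (11 * s) := by
    calc _ ≤ m ^ s * ((m ^ 4) ^ s * (m ^ 4) ^ s) * m ^ (2 * s) := by gcongr
      _ = m ^ (11 * s) := by rw [← pow_mul, ← pow_add, ← pow_add, ← pow_add]; congr 1; ring
  have hm0 : (0 : ℝ) < m := by exact_mod_cast (by omega : 0 < m)
  have hlogm : 0 ≤ Real.log m := Real.log_nonneg (by exact_mod_cast (by omega : 1 ≤ m))
  have hpow : ((m : ℝ)) ^ (11 * s) ≤ Real.exp (n / 16) := by
    rw [← Real.exp_log hm0, ← Real.exp_nat_mul]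
    refine Real.exp_le_exp.mpr ?_
    push_cast
    have : 0 ≤ (s : ℝ) * Real.log m := by positivity
    nlinarith
  have hreal : (p.choose s : ℝ) * (((2 * (16 * n * p ^ 2) + 1) ^ s : ℕ) *
      ((2 * (16 * n * p ^ 2) + 1) ^ s : ℕ)) * (n * p) ≤ Real.exp (n / 16) := by
    refine le_trans ?_ hpow
    exact_mod_cast hnat
  have hnp0 : (0 : ℝ) < n * p := by
    have : 0 < n * p := Nat.mul_pos (by omega) (by omega)
    exact_mod_cast this
  rw [le_div_iff₀ hnp0, neg_div, Real.exp_neg]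
  calc _ = (p.choose s : ℝ) * (((2 * (16 * n * p ^ 2) + 1) ^ s : ℕ) *
      ((2 * (16 * n * p ^ 2) + 1) ^ s : ℕ)) * (n * p) * (Real.exp (n / 16))⁻¹ := by ring
    _ ≤ Real.exp (n / 16) * (Real.exp (n / 16))⁻¹ := by gcongr
    _ = 1 := mul_inv_cancel₀ (Real.exp_pos _).ne'

/-- uniform lower bound on the smallest eigenvalue of the Poisson Fisher
information, over all sparse models and all coefficients. -/
theorem stmt_14 : ∃ C : ℝ, 0 < C ∧
    ∀ n p sstar : ℕ, 1 ≤ n → 1 ≤ sstar → sstar ≤ p →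
      C ≤ (p : ℝ) → C * (sstar : ℝ) * Real.log (max n p : ℕ) ≤ (n : ℝ) →
      gaussMat n p {x | ∃ S : Finset (Fin p), S.Nonempty ∧ S.card ≤ sstar ∧
          ∃ θs : S → ℝ,
            lamMin (gramW S (fun i => Real.exp (∑ j : S, x i j.1 * θs j)) x) ≤ (n : ℝ) / 540}
        ≤ ENNReal.ofReal (2 / ((n : ℝ) * p) + 3 * Real.exp (-(n : ℝ) / 50) +
            3 * Real.exp (-(n : ℝ) / 30) + 3 * Real.exp (-(n : ℝ) / 240)) := by
  refine ⟨1000, by norm_num, fun n p s hn hs hsp hp hlog => ?_⟩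
  have hp' : 1000 ≤ p := by exact_mod_cast hp
  have hn0 : (0 : ℝ) < n := by exact_mod_cast hn
  have hp0 : (0 : ℝ) < p := by linarith
  have : IsProbabilityMeasure (gaussMat n p) := by unfold gaussMat; infer_instance
  have hK : 0 < 16 * n * p ^ 2 := by positivity
  choose N hNcard hNunit hN using fun S : Finset (Fin p) => exists_net_sparse_unit S hK
  set B := ⋃ S ∈ Finset.powersetCard s (Finset.univ : Finset (Fin p)),
    ⋃ q ∈ N S ×ˢ N S, fewHits n q.1 q.2 with hB
  have hsub : {x | ∃ S : Finset (Fin p), S.Nonempty ∧ S.card ≤ s ∧ ∃ θs : S → ℝ,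
      lamMin (gramW S (fun i => Real.exp (∑ j : S, x i j.1 * θs j)) x) ≤ (n : ℝ) / 540} ⊆
      {x | ∃ i j, (n : ℝ) * p ≤ |x i j|} ∪ B := by
    rintro x ⟨S, hS, hcard, θ, hle⟩
    by_contra hx
    rw [Set.mem_union, not_or] at hx
    obtain ⟨hx1, hx2⟩ := hx
    refine absurd hle (not_le.mpr (lt_lamMin_gramW_exp hn (by omega) hsp N hN (fun i j => ?_)
      (fun T hT q hq hfew => hx2 ?_) hS hcard θ))
    · by_contra h
      exact hx1 ⟨i, j, (not_le.mp h).le⟩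
    · exact Set.mem_biUnion hT (Set.mem_biUnion hq hfew)
  have hBle : (gaussMat n p).real B ≤ 1 / (n * p) := by
    refine le_trans ?_ (net_card_mul_exp_le hn hs (by omega) hlog)
    calc (gaussMat n p).real B
        ≤ ∑ S ∈ Finset.powersetCard s (Finset.univ : Finset (Fin p)),
            (gaussMat n p).real (⋃ q ∈ N S ×ˢ N S, fewHits n q.1 q.2) :=
          measureReal_biUnion_finset_le _ _
      _ ≤ ∑ S ∈ Finset.powersetCard s (Finset.univ : Finset (Fin p)),
            (((2 * (16 * n * p ^ 2) + 1) ^ s : ℕ) * ((2 * (16 * n * p ^ 2) + 1) ^ s : ℕ) *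
              Real.exp (-(n : ℝ) / 16)) := by
          refine Finset.sum_le_sum fun S hS => ?_
          have hc := hNcard S
          rw [(Finset.mem_powersetCard.mp hS).2] at hc
          calc (gaussMat n p).real (⋃ q ∈ N S ×ˢ N S, fewHits n q.1 q.2)
              ≤ ∑ q ∈ N S ×ˢ N S, (gaussMat n p).real (fewHits n q.1 q.2) :=
                measureReal_biUnion_finset_le _ _
            _ ≤ ∑ _q ∈ N S ×ˢ N S, Real.exp (-(n : ℝ) / 16) := by
                refine Finset.sum_le_sum fun q hq => ?_
                obtain ⟨hq1, hq2⟩ := Finset.mem_product.mp hq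
                exact pi_few_hits_le _ (measurableSet_halfspace_slab q.1 q.2)
                  (pi_gaussianReal_halfspace_slab q.1 q.2 (hNunit S _ hq1) (hNunit S _ hq2)) n
            _ = ((N S).card * (N S).card : ℝ) * Real.exp (-(n : ℝ) / 16) := by
                rw [Finset.sum_const, Finset.card_product, nsmul_eq_mul, Nat.cast_mul]
            _ ≤ _ := by gcongr
      _ = _ := by
          rw [Finset.sum_const, Finset.card_powersetCard, Finset.card_univ, Fintype.card_fin,
            nsmul_eq_mul]
  have hentry := gaussMat_large_entry_le (n := n) (p := p) (mul_pos hn0 hp0)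
  have hentry' : (n : ℝ) * p * (1 / (n * p) ^ 2) = 1 / (n * p) := by field_simp
  rw [hentry'] at hentry
  have htotal := (measureReal_mono (μ := gaussMat n p) hsub).trans (measureReal_union_le _ _)
  rw [← ofReal_measureReal]
  refine ENNReal.ofReal_le_ofReal ?_
  have h2 : 2 / ((n : ℝ) * p) = 1 / (n * p) + 1 / (n * p) := by ring
  have := Real.exp_pos (-(n : ℝ) / 50)
  have := Real.exp_pos (-(n : ℝ) / 30)
  have := Real.exp_pos (-(n : ℝ) / 240)
  linarith
end
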